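/- arXiv:1902.00444 — 3 statements merged into one kernel-verified Lean document; each statement's English description precedes it below -/
import Mathlib

section
/- Let E(λ)=A+λB be an n×n *-odd matrix pencil over ℂ (i.e., A^*=−A, B^*=B) whose rank equals r (r ≤ n). Then there exist nonnegative integers ℓ, s with ℓ+2s=r, real numbers a_1,…,a_ℓ, b_1,…,b_ℓ, vectors u_1,…,u_ℓ, v_1,…,v_s ∈ ℂ^n, and vector pencils w_1,…,w_s of degree at most one such that A+λB = Σ_{i=1}^{ℓ} (i a_i+λ b_i) u_i u_i^* + Σ_{j=1}^{s} ( v_j w_j(λ)^* − w_j(−λ) v_j^* ), where i denotes the imaginary unit. -/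
open Matrix BigOperators

/-- The rank of the pencil `A + λ B` (the maximum over `μ ∈ ℂ` of the rank of
`A + μ B`) equals `r`. -/
def PencilRankEq (n : ℕ) (A B : Matrix (Fin n) (Fin n) ℂ) (r : ℕ) : Prop :=
  (∃ μ : ℂ, (A + μ • B).rank = r) ∧ ∀ μ : ℂ, (A + μ • B).rank ≤ r

open Filter

section HermitianPair

open scoped ComplexOrder

variable {n : ℕ}

/-- `(H, B)` is a sum of `ℓ` simultaneously diagonal Hermitian rank-one pairs and `s` pairs
`(v cᴴ + c vᴴ, v dᴴ + d vᴴ)`, with `ℓ + 2 s = r`. -/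
def HasHermitianDecomposition (r : ℕ) (H B : Matrix (Fin n) (Fin n) ℂ) : Prop :=
  ∃ (ℓ s : ℕ), ℓ + 2 * s = r ∧
    ∃ (a b : Fin ℓ → ℝ) (u : Fin ℓ → Fin n → ℂ) (v c d : Fin s → Fin n → ℂ),
      H = (∑ i, (a i : ℂ) • vecMulVec (u i) (star (u i)))
          + ∑ j, (vecMulVec (v j) (star (c j)) + vecMulVec (c j) (star (v j))) ∧
      B = (∑ i, (b i : ℂ) • vecMulVec (u i) (star (u i)))
          + ∑ j, (vecMulVec (v j) (star (d j)) + vecMulVec (d j) (star (v j)))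

theorem hasHermitianDecomposition_zero (r : ℕ) :
    HasHermitianDecomposition r (0 : Matrix (Fin n) (Fin n) ℂ) 0 :=
  ⟨r, 0, by simp, 0, 0, 0, 0, 0, 0, by simp, by simp⟩

theorem HasHermitianDecomposition.add_diagonal {r : ℕ} {H B : Matrix (Fin n) (Fin n) ℂ}
    (h : HasHermitianDecomposition r H B) (a b : ℝ) (u : Fin n → ℂ) :
    HasHermitianDecomposition (r + 1) (H + (a : ℂ) • vecMulVec u (star u))
      (B + (b : ℂ) • vecMulVec u (star u)) := by
  obtain ⟨ℓ, s, hr, a', b', u', v, c, d, rfl, rfl⟩ := h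
  refine ⟨ℓ + 1, s, by omega, Fin.cons a a', Fin.cons b b', Fin.cons u u', v, c, d, ?_, ?_⟩ <;>
  · simp only [Fin.sum_univ_succ, Fin.cons_zero, Fin.cons_succ]
    abel

theorem HasHermitianDecomposition.add_hyperbolic {r : ℕ} {H B : Matrix (Fin n) (Fin n) ℂ}
    (h : HasHermitianDecomposition r H B) (v c d : Fin n → ℂ) :
    HasHermitianDecomposition (r + 2) (H + (vecMulVec v (star c) + vecMulVec c (star v)))
      (B + (vecMulVec v (star d) + vecMulVec d (star v))) := by
  obtain ⟨ℓ, s, hr, a, b, u, v', c', d', rfl, rfl⟩ := h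
  refine ⟨ℓ, s + 1, by omega, a, b, u, Fin.cons v v', Fin.cons c c', Fin.cons d d', ?_, ?_⟩ <;>
  · simp only [Fin.sum_univ_succ, Fin.cons_zero, Fin.cons_succ]
    abel

theorem rank_add_finrank_ker_mulVecLin (M : Matrix (Fin n) (Fin n) ℂ) :
    M.rank + Module.finrank ℂ (LinearMap.ker M.mulVecLin) = n := by
  simpa [Matrix.rank] using M.mulVecLin.finrank_range_add_finrank_ker

theorem star_dotProduct_mulVec_of_isHermitian {M : Matrix (Fin n) (Fin n) ℂ}
    (hM : M.IsHermitian) (x w : Fin n → ℂ) : star x ⬝ᵥ (M *ᵥ w) = star (M *ᵥ x) ⬝ᵥ w := by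
  rw [star_mulVec, hM.eq, dotProduct_mulVec]

theorem star_dotProduct_eq_zero_of_mulVec_eq_zero {M : Matrix (Fin n) (Fin n) ℂ}
    (hM : M.IsHermitian) {x y w : Fin n → ℂ} {γ : ℂ} (hγ : γ ≠ 0) (hx : M *ᵥ x = γ • y)
    (hw : M *ᵥ w = 0) : star y ⬝ᵥ w = 0 := by
  have h := star_dotProduct_mulVec_of_isHermitian hM x w
  rw [hw, hx, dotProduct_zero, star_smul, smul_dotProduct, smul_eq_mul] at h
  simpa [hγ] using h.symm

theorem rank_sub_diagonal_lt {M : Matrix (Fin n) (Fin n) ℂ} (hM : M.IsHermitian)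
    {x y : Fin n → ℂ} {γ a : ℂ} (hγ : γ ≠ 0) (hy : y ≠ 0) (hx : M *ᵥ x = γ • y)
    (ha : a * (star y ⬝ᵥ x) = γ) : (M - a • vecMulVec y (star y)).rank + 1 ≤ M.rank := by
  have key (w : Fin n → ℂ) : (M - a • vecMulVec y (star y)) *ᵥ w
      = M *ᵥ w - (a * (star y ⬝ᵥ w)) • y := by
    simp [sub_mulVec, smul_mulVec, vecMulVec_mulVec, smul_smul]
  have hlt : LinearMap.ker M.mulVecLin
      < LinearMap.ker (M - a • vecMulVec y (star y)).mulVecLin := by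
    refine SetLike.lt_iff_le_and_exists.2 ⟨fun w hw ↦ ?_, x, ?_, ?_⟩
    · rw [LinearMap.mem_ker, mulVecLin_apply] at hw ⊢
      rw [key, hw, star_dotProduct_eq_zero_of_mulVec_eq_zero hM hγ hx hw]
      simp
    · rw [LinearMap.mem_ker, mulVecLin_apply, key, hx, ha, sub_self]
    · simp [hx, hγ, hy]
  have h1 := Submodule.finrank_lt_finrank_of_lt hlt
  have h2 := rank_add_finrank_ker_mulVecLin M
  have h3 := rank_add_finrank_ker_mulVecLin (M - a • vecMulVec y (star y))
  omega

/-- The vector `c` for which subtracting `y cᴴ + c yᴴ` from a Hermitian matrix `M` compresses `M`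
to `yᗮ` along `z`, provided `zᴴ y = 1`. -/
noncomputable def hyperbolicPart (M : Matrix (Fin n) (Fin n) ℂ) (y z : Fin n → ℂ) : Fin n → ℂ :=
  M *ᵥ z - ((1 / 2 : ℂ) * (star z ⬝ᵥ (M *ᵥ z))) • y

theorem hyperbolicPart_add_smul (H B : Matrix (Fin n) (Fin n) ℂ) (y z : Fin n → ℂ) (t : ℂ) :
    hyperbolicPart (H + t • B) y z = hyperbolicPart H y z + t • hyperbolicPart B y z := by
  simp only [hyperbolicPart, add_mulVec, smul_mulVec, dotProduct_add, dotProduct_smul, smul_eq_mul]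
  module

/-- The compression of a Hermitian matrix `M` to `yᗮ` along `z`. -/
noncomputable def compression (M : Matrix (Fin n) (Fin n) ℂ) (y z : Fin n → ℂ) :
    Matrix (Fin n) (Fin n) ℂ :=
  M - (vecMulVec y (star (hyperbolicPart M y z)) + vecMulVec (hyperbolicPart M y z) (star y))

theorem isHermitian_compression {M : Matrix (Fin n) (Fin n) ℂ} (hM : M.IsHermitian)
    (y z : Fin n → ℂ) : (compression M y z).IsHermitian := by
  rw [Matrix.IsHermitian, compression, conjTranspose_sub, conjTranspose_add,
    conjTranspose_vecMulVec, conjTranspose_vecMulVec, hM.eq, star_star, star_star, add_comm]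

theorem compression_add_smul (H B : Matrix (Fin n) (Fin n) ℂ) (y z : Fin n → ℂ) (t : ℝ) :
    compression (H + (t : ℂ) • B) y z = compression H y z + (t : ℂ) • compression B y z := by
  simp only [compression, hyperbolicPart_add_smul, star_add, star_smul, vecMulVec_add,
    add_vecMulVec, vecMulVec_smul, smul_vecMulVec, Complex.star_def, Complex.conj_ofReal]
  module

theorem rank_compression_lt {M : Matrix (Fin n) (Fin n) ℂ} (hM : M.IsHermitian)
    {x y z : Fin n → ℂ} {γ : ℂ} (hγ : γ ≠ 0) (hy : y ≠ 0) (hx : M *ᵥ x = γ • y)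
    (hyx : star y ⬝ᵥ x = 0) (hzy : star z ⬝ᵥ y = 1) :
    (compression M y z).rank + 2 ≤ M.rank := by
  have hyz : star y ⬝ᵥ z = 1 := by
    rw [star_dotProduct, hzy, star_one]
  have hreal : star (star z ⬝ᵥ (M *ᵥ z)) = star z ⬝ᵥ (M *ᵥ z) := by
    conv_rhs => rw [star_dotProduct_mulVec_of_isHermitian hM, star_dotProduct]
  have hpart (w : Fin n → ℂ) : star (hyperbolicPart M y z) ⬝ᵥ w
      = star z ⬝ᵥ (M *ᵥ w) - 1 / 2 * (star z ⬝ᵥ (M *ᵥ z)) * (star y ⬝ᵥ w) := by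
    rw [hyperbolicPart, star_sub, star_smul, sub_dotProduct, smul_dotProduct, star_mul', hreal,
      star_dotProduct_mulVec_of_isHermitian hM z w]
    simp
  have key (w : Fin n → ℂ) : compression M y z *ᵥ w = M *ᵥ w
      - ((star (hyperbolicPart M y z) ⬝ᵥ w) • y + (star y ⬝ᵥ w) • hyperbolicPart M y z) := by
    simp [compression, sub_mulVec, add_mulVec, vecMulVec_mulVec]
  let K : Submodule ℂ (Fin n → ℂ) := LinearMap.ker (compression M y z).mulVecLin ⊓
    LinearMap.ker (dotProductBilin ℂ ℂ (star y))
  have hlt₁ : LinearMap.ker M.mulVecLin < K := by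
    refine SetLike.lt_iff_le_and_exists.2 ⟨fun w hw ↦ ?_, x, Submodule.mem_inf.2 ⟨?_, ?_⟩, ?_⟩
    · rw [LinearMap.mem_ker, mulVecLin_apply] at hw
      have hw' := star_dotProduct_eq_zero_of_mulVec_eq_zero hM hγ hx hw
      refine ⟨?_, ?_⟩
      · simp [key, hpart, hw, hw']
      · simpa using hw'
    · simp [key, hpart, hx, hyx, hzy]
    · simpa using hyx
    · simp [hx, hγ, hy]
  have hlt₂ : K < LinearMap.ker (compression M y z).mulVecLin := by
    refine SetLike.lt_iff_le_and_exists.2 ⟨inf_le_left, z, ?_, fun h ↦ ?_⟩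
    · rw [LinearMap.mem_ker, mulVecLin_apply, key, hpart, hyz, hyperbolicPart]
      module
    · have := h.2
      simp [hyz] at this
  have h1 := Submodule.finrank_lt_finrank_of_lt hlt₁
  have h2 := Submodule.finrank_lt_finrank_of_lt hlt₂
  have h3 := rank_add_finrank_ker_mulVecLin M
  have h4 := rank_add_finrank_ker_mulVecLin (compression M y z)
  omega

/-- An inclusion between kernels of Hermitian matrices reverses for their ranges. -/
theorem range_mulVecLin_le_of_ker_le {H B : Matrix (Fin n) (Fin n) ℂ} (hH : H.IsHermitian)
    (hB : B.IsHermitian) (h : LinearMap.ker B.mulVecLin ≤ LinearMap.ker H.mulVecLin) :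
    LinearMap.range H.mulVecLin ≤ LinearMap.range B.mulVecLin := by
  obtain ⟨g, hg⟩ := B.mulVecLin.rangeRestrict.exists_rightInverse_of_surjective
    (LinearMap.range_rangeRestrict _)
  obtain ⟨C, hC⟩ := LinearMap.exists_extend (H.mulVecLin ∘ₗ g)
  have hHC : H = LinearMap.toMatrix' C * B := by
    refine Matrix.mulVec_injective (funext fun w ↦ ?_)
    have h₁ : C (B *ᵥ w) = H *ᵥ g (B.mulVecLin.rangeRestrict w) :=
      LinearMap.congr_fun hC (B.mulVecLin.rangeRestrict w)
    have h₂ : B *ᵥ g (B.mulVecLin.rangeRestrict w) = B *ᵥ w :=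
      congrArg Subtype.val (LinearMap.congr_fun hg (B.mulVecLin.rangeRestrict w))
    have h₃ : w - g (B.mulVecLin.rangeRestrict w) ∈ LinearMap.ker H.mulVecLin :=
      h (by simp [mulVec_sub, h₂])
    rw [LinearMap.mem_ker, mulVecLin_apply, mulVec_sub, sub_eq_zero] at h₃
    rw [← mulVec_mulVec, LinearMap.toMatrix'_mulVec, h₁, h₃]
  have hHB : H = B * (LinearMap.toMatrix' C)ᴴ := by
    rw [← hH.eq, hHC, conjTranspose_mul, hB.eq]
  rw [hHB, mulVecLin_mul]
  exact LinearMap.range_comp_le_range _ _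

/-- A nonzero Hermitian pencil has an eigenvector outside its common kernel, possibly for the
eigenvalue at infinity. -/
theorem exists_mulVec_eq_smul {H B : Matrix (Fin n) (Fin n) ℂ} (hH : H.IsHermitian)
    (hB : B.IsHermitian) (hne : ¬ (H = 0 ∧ B = 0)) :
    ∃ (x y : Fin n → ℂ) (α β : ℂ), y ≠ 0 ∧ (α ≠ 0 ∨ β ≠ 0) ∧
      H *ᵥ x = α • y ∧ B *ᵥ x = β • y := by
  by_cases hker : LinearMap.ker B.mulVecLin ≤ LinearMap.ker H.mulVecLin
  · have hrange := range_mulVecLin_le_of_ker_le hH hB hker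
    have hR : Nontrivial (LinearMap.range B.mulVecLin) := by
      rw [Submodule.nontrivial_iff_ne_bot]
      intro h
      rw [h, le_bot_iff] at hrange
      exact hne ⟨toLin'.map_eq_zero_iff.1 (LinearMap.range_eq_bot.1 hrange),
        toLin'.map_eq_zero_iff.1 (LinearMap.range_eq_bot.1 h)⟩
    obtain ⟨g, hg⟩ := B.mulVecLin.rangeRestrict.exists_rightInverse_of_surjective
      (LinearMap.range_rangeRestrict _)
    let f : Module.End ℂ (LinearMap.range B.mulVecLin) :=
      (H.mulVecLin ∘ₗ g).codRestrict _ fun y ↦ hrange ⟨g y, rfl⟩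
    obtain ⟨μ, hμ⟩ := Module.End.exists_eigenvalue f
    obtain ⟨y, hy⟩ := hμ.exists_hasEigenvector
    refine ⟨g y, y, μ, 1, by simpa using hy.2, by simp, ?_, ?_⟩
    · exact congrArg Subtype.val hy.apply_eq_smul
    · simpa using congrArg Subtype.val (LinearMap.congr_fun hg y)
  · obtain ⟨x, hx, hx'⟩ := SetLike.not_le_iff_exists.1 hker
    exact ⟨x, H *ᵥ x, 1, 0, hx', by simp, by simp, by simpa using hx⟩

theorem eventually_add_mul_ne_zero {α β : ℂ} (h : α ≠ 0 ∨ β ≠ 0) :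
    ∀ᶠ t : ℝ in cofinite, α + t * β ≠ 0 := by
  rw [eventually_cofinite]
  refine Set.Subsingleton.finite fun t ht t' ht' ↦ ?_
  simp only [ne_eq, not_not, Set.mem_ofPred_eq] at ht ht'
  by_cases hβ : β = 0
  · simp_all
  · have : (t : ℂ) * β = t' * β := by linear_combination ht - ht'
    exact_mod_cast mul_right_cancel₀ hβ this

/-- If `H x = α y` with `H` Hermitian and `yᴴ x ≠ 0`, then `α / yᴴ x` is real. -/
theorem exists_real_mul_star_dotProduct_eq {H : Matrix (Fin n) (Fin n) ℂ} (hH : H.IsHermitian)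
    {x y : Fin n → ℂ} {α : ℂ} (hx : H *ᵥ x = α • y) (hyx : star y ⬝ᵥ x ≠ 0) :
    ∃ a : ℝ, (a : ℂ) * (star y ⬝ᵥ x) = α := by
  have h := star_dotProduct_mulVec_of_isHermitian hH x x
  have hxy : star x ⬝ᵥ y = star (star y ⬝ᵥ x) := star_dotProduct x y
  rw [hx, dotProduct_smul, star_smul, smul_dotProduct, hxy] at h
  simp only [smul_eq_mul, Complex.star_def] at h
  obtain ⟨a, ha⟩ := Complex.conj_eq_iff_real.1
    (show (starRingEnd ℂ) (α / (star y ⬝ᵥ x)) = α / (star y ⬝ᵥ x) by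
      rw [map_div₀, div_eq_div_iff (by simpa using hyx) hyx, ← h])
  exact ⟨a, by rw [← ha, div_mul_cancel₀ _ hyx]⟩

theorem hasHermitianDecomposition_of_rank_le (r : ℕ) (H B : Matrix (Fin n) (Fin n) ℂ)
    (hH : H.IsHermitian) (hB : B.IsHermitian)
    (hr : ∀ᶠ t : ℝ in cofinite, (H + (t : ℂ) • B).rank ≤ r) :
    HasHermitianDecomposition r H B := by
  induction r using Nat.strong_induction_on generalizing H B with
  | _ r ih =>
  by_cases hne : H = 0 ∧ B = 0
  · obtain ⟨rfl, rfl⟩ := hne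
    exact hasHermitianDecomposition_zero r
  obtain ⟨x, y, α, β, hy, hαβ, hHx, hBx⟩ := exists_mulVec_eq_smul hH hB hne
  have hE (t : ℝ) : (H + (t : ℂ) • B) *ᵥ x = (α + t * β) • y := by
    rw [add_mulVec, smul_mulVec, hHx, hBx, smul_smul, add_smul]
  have hherm (t : ℝ) : (H + (t : ℂ) • B).IsHermitian :=
    hH.add (hB.smul (Complex.conj_ofReal t))
  by_cases hyx : star y ⬝ᵥ x = 0
  · obtain ⟨z, hzy⟩ : ∃ z : Fin n → ℂ, star z ⬝ᵥ y = 1 := by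
      refine ⟨(star y ⬝ᵥ y)⁻¹ • y, ?_⟩
      have h0 : star y ⬝ᵥ y ≠ 0 := mt dotProduct_star_self_eq_zero.1 hy
      have h1 : star (star y ⬝ᵥ y) = star y ⬝ᵥ y := (star_dotProduct y y).symm
      rw [star_smul, smul_dotProduct, star_inv₀, h1, smul_eq_mul, inv_mul_cancel₀ h0]
    have hlt : ∀ᶠ t : ℝ in cofinite,
        (compression H y z + (t : ℂ) • compression B y z).rank + 2 ≤ r := by
      filter_upwards [hr, eventually_add_mul_ne_zero hαβ] with t ht hγ
      rw [← compression_add_smul]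
      exact (rank_compression_lt (hherm t) hγ hy (hE t) hyx hzy).trans ht
    obtain ⟨t, ht⟩ := hlt.exists
    obtain ⟨k, rfl⟩ : ∃ k, r = k + 2 := ⟨r - 2, by omega⟩
    have h := (ih k (by omega) _ _ (isHermitian_compression hH y z)
      (isHermitian_compression hB y z) (hlt.mono fun t ht ↦ by omega)).add_hyperbolic y
      (hyperbolicPart H y z) (hyperbolicPart B y z)
    simpa [compression] using h
  · obtain ⟨a, ha⟩ := exists_real_mul_star_dotProduct_eq hH hHx hyx
    obtain ⟨b, hb⟩ := exists_real_mul_star_dotProduct_eq hB hBx hyx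
    have hdiag (a : ℝ) : ((a : ℂ) • vecMulVec y (star y)).IsHermitian := by
      rw [Matrix.IsHermitian, conjTranspose_smul, conjTranspose_vecMulVec, star_star,
        Complex.star_def, Complex.conj_ofReal]
    have hlt : ∀ᶠ t : ℝ in cofinite, ((H - (a : ℂ) • vecMulVec y (star y))
        + (t : ℂ) • (B - (b : ℂ) • vecMulVec y (star y))).rank + 1 ≤ r := by
      filter_upwards [hr, eventually_add_mul_ne_zero hαβ] with t ht hγ
      refine le_trans ?_ ht
      have hsub : (H - (a : ℂ) • vecMulVec y (star y))
          + (t : ℂ) • (B - (b : ℂ) • vecMulVec y (star y))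
          = (H + (t : ℂ) • B) - (a + t * b : ℂ) • vecMulVec y (star y) := by module
      rw [hsub]
      exact rank_sub_diagonal_lt (hherm t) hγ hy (hE t) (by rw [← ha, ← hb]; ring)
    obtain ⟨t, ht⟩ := hlt.exists
    obtain ⟨k, rfl⟩ : ∃ k, r = k + 1 := ⟨r - 1, by omega⟩
    have h := (ih k (by omega) _ _ (hH.sub (hdiag a)) (hB.sub (hdiag b))
      (hlt.mono fun t ht ↦ by omega)).add_diagonal a b y
    simpa using h

end HermitianPair

/-- **Rank-1 decomposition for *-odd pencils.**
If `E(λ) = A + λB` is an `n × n` *-odd matrix pencil (`Aᴴ = -A`, `Bᴴ = B`) of rank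
`r ≤ n`, then there exist `ℓ, s` with `ℓ + 2s = r`, real numbers `a_i, b_i`, vectors
`u_i, v_j ∈ ℂ^n`, and vector pencils `w_j(λ) = c_j + λ d_j` of degree at most one
such that `A + λB = Σ (𝕚 a_i + λ b_i) u_i u_i^* + Σ (v_j w_j(λ)^* − w_j(−λ) v_j^*)`. -/
theorem star_odd_rank_one_decomposition
    (n r : ℕ) (hrn : r ≤ n) (A B : Matrix (Fin n) (Fin n) ℂ)
    (hA : Aᴴ = -A) (hB : Bᴴ = B)
    (hrank : PencilRankEq n A B r) :
    ∃ (ℓ s : ℕ), ℓ + 2 * s = r ∧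
      ∃ (a b : Fin ℓ → ℝ) (u : Fin ℓ → Fin n → ℂ)
        (v c d : Fin s → Fin n → ℂ),
        ∀ lam : ℂ,
          A + lam • B =
            (∑ i : Fin ℓ,
              (Complex.I * (a i : ℂ) + lam * (b i : ℂ)) • vecMulVec (u i) (star (u i)))
            + ∑ j : Fin s,
                (vecMulVec (v j) (star (c j) + lam • star (d j))
                  - vecMulVec (c j - lam • d j) (star (v j))) := by
  have hH : ((-Complex.I) • A).IsHermitian := by
    rw [Matrix.IsHermitian, conjTranspose_smul, hA]
    simp
  have hr : ∀ t : ℝ, ((-Complex.I) • A + (t : ℂ) • B).rank ≤ r := by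
    intro t
    have h : (-Complex.I) • A + (t : ℂ) • B
        = (-Complex.I) • (A + (Complex.I * t) • B) := by
      rw [smul_add, smul_smul, ← mul_assoc]
      simp
    rw [h]
    rw [rank_smul_of_mem_nonZeroDivisors _ (mem_nonZeroDivisors_of_ne_zero (by simp))]
    exact hrank.2 _
  obtain ⟨ℓ, s, hls, a, b, u, v, c, d, hHeq, hBeq⟩ :=
    hasHermitianDecomposition_of_rank_le r _ _ hH hB (Eventually.of_forall hr)
  refine ⟨ℓ, s, hls, a, b, u, v, fun j ↦ (-Complex.I) • c j, d, fun lam ↦ ?_⟩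
  have hAeq : A = Complex.I • ((-Complex.I) • A) := by simp [smul_smul]
  rw [hAeq, hHeq]
  conv_lhs => rw [hBeq]
  simp only [smul_add, Finset.smul_sum]
  rw [add_add_add_comm, ← Finset.sum_add_distrib, ← Finset.sum_add_distrib]
  congr 1
  · refine Finset.sum_congr rfl fun i _ ↦ ?_
    module
  · refine Finset.sum_congr rfl fun j _ ↦ ?_
    simp only [star_smul, vecMulVec_add, vecMulVec_smul, sub_vecMulVec, smul_vecMulVec, star_neg,
      Complex.star_def, Complex.conj_I, neg_neg]
    module
end

section
/- Let E(λ)=A+λB be an n×n *-palindromic matrix pencil over ℂ (i.e., A^*=B) whose rank equals r (r ≤ n). Then there exist nonnegative integers ℓ, s with ℓ+2s=r, real numbers a_1,…,a_ℓ, b_1,…,b_ℓ, vectors u_1,…,u_ℓ, v_1,…,v_s ∈ ℂ^n, and vector pencils w_1,…,w_s of degree at most one such that A+λB = Σ_{i=1}^{ℓ} ( (a_i−i b_i) + λ(a_i+i b_i) ) u_i u_i^* + Σ_{j=1}^{s} ( v_j w_j(λ)^* + (rev w_j)(λ) v_j^* ), where i denotes the imaginary unit. -/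
open Matrix BigOperators

section RankOneDecomposition

variable {m : Type*}

/-- `A` is a sum of `ℓ` multiples of `u uᴴ` and `s` terms `v cᴴ + d vᴴ` with `ℓ + 2 s ≤ r`. -/
def HasRankOneDecomposition (A : Matrix m m ℂ) (r : ℕ) : Prop :=
  ∃ (ℓ s : ℕ), ℓ + 2 * s ≤ r ∧
    ∃ (a : Fin ℓ → ℂ) (u : Fin ℓ → m → ℂ) (v c d : Fin s → m → ℂ),
      A = (∑ i, a i • vecMulVec (u i) (star (u i)))
        + ∑ j, (vecMulVec (v j) (star (c j)) + vecMulVec (d j) (star (v j)))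

lemma HasRankOneDecomposition.add_smul_vecMulVec {A : Matrix m m ℂ} {r : ℕ}
    (h : HasRankOneDecomposition A r) (a : ℂ) (u : m → ℂ) :
    HasRankOneDecomposition (A + a • vecMulVec u (star u)) (r + 1) := by
  obtain ⟨ℓ, s, hr, a', u', v, c, d, rfl⟩ := h
  refine ⟨ℓ + 1, s, by omega, Fin.cons a a', Fin.cons u u', v, c, d, ?_⟩
  rw [Fin.sum_univ_succ]
  simp only [Fin.cons_zero, Fin.cons_succ]
  abel

lemma HasRankOneDecomposition.add_vecMulVec_pair {A : Matrix m m ℂ} {r : ℕ}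
    (h : HasRankOneDecomposition A r) (v c d : m → ℂ) :
    HasRankOneDecomposition (A + (vecMulVec v (star c) + vecMulVec d (star v))) (r + 2) := by
  obtain ⟨ℓ, s, hr, a, u, v', c', d', rfl⟩ := h
  refine ⟨ℓ, s + 1, by omega, a, u, Fin.cons v v', Fin.cons c c', Fin.cons d d', ?_⟩
  rw [Fin.sum_univ_succ (n := s)]
  simp only [Fin.cons_zero, Fin.cons_succ]
  abel

variable [Fintype m]

open scoped ComplexOrder in
/-- A complex vector orthogonal to itself vanishes. -/
lemma eq_zero_of_star_dotProduct_self_eq_zero {y : m → ℂ} (h : star y ⬝ᵥ y = 0) : y = 0 :=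
  dotProduct_star_self_eq_zero.mp h

/-- The ranges of `A` and `Aᴴ` together meet the common kernel of `A` and `Aᴴ` trivially. -/
lemma eq_zero_of_mem_range_sup_range_conjTranspose (A : Matrix m m ℂ) {y : m → ℂ}
    (hy : y ∈ LinearMap.range A.mulVecLin ⊔ LinearMap.range Aᴴ.mulVecLin)
    (h₁ : A *ᵥ y = 0) (h₂ : Aᴴ *ᵥ y = 0) : y = 0 := by
  obtain ⟨_, ⟨w, rfl⟩, _, ⟨z, rfl⟩, hsum⟩ := Submodule.mem_sup.mp hy
  simp only [mulVecLin_apply] at hsum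
  have hw : star y ⬝ᵥ (A *ᵥ w) = 0 := by
    have h := congrArg star h₂
    rw [star_mulVec, conjTranspose_conjTranspose] at h
    rw [dotProduct_mulVec, h, star_zero, zero_dotProduct]
  have hz : star y ⬝ᵥ (Aᴴ *ᵥ z) = 0 := by
    have h := congrArg star h₁
    rw [star_mulVec] at h
    rw [dotProduct_mulVec, h, star_zero, zero_dotProduct]
  have h : star y ⬝ᵥ y = 0 := by
    conv_lhs => rw [← hsum, dotProduct_add, hsum]
    rw [hw, hz, add_zero]
  exact eq_zero_of_star_dotProduct_self_eq_zero h

/-- A nonzero matrix `A` admits a vector whose images under `A` and `Aᴴ` are proportional and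
not both zero. -/
lemma exists_mulVec_proportional_conjTranspose_mulVec (A : Matrix m m ℂ) (hA : A ≠ 0) :
    ∃ (x v : m → ℂ) (p q : ℂ), v ≠ 0 ∧ (p ≠ 0 ∨ q ≠ 0) ∧
      A *ᵥ x = p • v ∧ Aᴴ *ᵥ x = q • v := by
  classical
  set R := LinearMap.range A.mulVecLin ⊔ LinearMap.range Aᴴ.mulVecLin
  have hf : ∀ y ∈ R, A.mulVecLin y ∈ R := fun y _ => Submodule.mem_sup_left ⟨y, rfl⟩
  have hg : ∀ y ∈ R, Aᴴ.mulVecLin y ∈ R := fun y _ => Submodule.mem_sup_right ⟨y, rfl⟩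
  let f : R →ₗ[ℂ] R := A.mulVecLin.restrict hf
  let g : R →ₗ[ℂ] R := Aᴴ.mulVecLin.restrict hg
  have : Nontrivial R := by
    rw [Submodule.nontrivial_iff_ne_bot]
    intro hbot
    apply hA
    have h : A.mulVecLin = 0 := by
      rw [← LinearMap.range_eq_bot, eq_bot_iff, ← hbot]
      exact le_sup_left
    ext i j
    have := congrFun (LinearMap.congr_fun h (Pi.single j 1)) i
    simpa using this
  by_cases hinj : Function.Injective f
  · let e := LinearEquiv.ofInjectiveEndo f hinj
    obtain ⟨μ, hμ⟩ := Module.End.exists_eigenvalue (e.symm.toLinearMap ∘ₗ g)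
    obtain ⟨x, hx⟩ := hμ.exists_hasEigenvector
    have hgx : g x = μ • f x := by
      have h := congrArg e hx.apply_eq_smul
      simpa [e] using h
    refine ⟨x, A *ᵥ x, 1, μ, ?_, Or.inl one_ne_zero, (one_smul _ _).symm, ?_⟩
    · intro h0
      exact hx.2 (hinj (by rw [map_zero]; exact Subtype.ext h0))
    · exact congrArg Subtype.val hgx
  · rw [← LinearMap.ker_eq_bot, Submodule.eq_bot_iff] at hinj
    push Not at hinj
    obtain ⟨x, hx, hx0⟩ := hinj
    have hAx : A *ᵥ (x : m → ℂ) = 0 := congrArg Subtype.val hx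
    refine ⟨x, Aᴴ *ᵥ x, 0, 1, ?_, Or.inr one_ne_zero, by rw [hAx, zero_smul],
      (one_smul _ _).symm⟩
    intro h0
    exact hx0 (Subtype.ext (eq_zero_of_mem_range_sup_range_conjTranspose A x.2 hAx h0))

/-- The rank drops by one when the kernel grows by a vector. -/
lemma rank_add_one_le_of_ker_lt {M N : Matrix m m ℂ}
    (h : LinearMap.ker M.mulVecLin < LinearMap.ker N.mulVecLin) : N.rank + 1 ≤ M.rank := by
  have h₁ := M.mulVecLin.finrank_range_add_finrank_ker
  have h₂ := N.mulVecLin.finrank_range_add_finrank_ker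
  have h₃ := Submodule.finrank_lt_finrank_of_lt h
  rw [Matrix.rank, Matrix.rank]
  omega

/-- The rank drops by two when the kernel grows by two steps. -/
lemma rank_add_two_le_of_ker_lt {M N : Matrix m m ℂ} {W : Submodule ℂ (m → ℂ)}
    (h : LinearMap.ker M.mulVecLin < W) (h' : W < LinearMap.ker N.mulVecLin) :
    N.rank + 2 ≤ M.rank := by
  have h₁ := M.mulVecLin.finrank_range_add_finrank_ker
  have h₂ := N.mulVecLin.finrank_range_add_finrank_ker
  have h₃ := Submodule.finrank_lt_finrank_of_lt h
  have h₄ := Submodule.finrank_lt_finrank_of_lt h'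
  rw [Matrix.rank, Matrix.rank]
  omega

/-- For unimodular `μ`, the kernel of `A + μ Aᴴ` is orthogonal to its range. -/
lemma star_dotProduct_eq_zero_of_mem_ker {A : Matrix m m ℂ} {μ k : ℂ} {x v y : m → ℂ}
    (hμ : star μ * μ = 1) (hk : k ≠ 0) (hx : (A + μ • Aᴴ) *ᵥ x = k • v)
    (hy : (A + μ • Aᴴ) *ᵥ y = 0) : star v ⬝ᵥ y = 0 := by
  have hM : (A + μ • Aᴴ)ᴴ = star μ • (A + μ • Aᴴ) := by
    rw [conjTranspose_add, conjTranspose_smul, conjTranspose_conjTranspose, smul_add, smul_smul,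
      hμ, one_smul, add_comm]
  have h : star (k • v) ⬝ᵥ y = 0 := by
    rw [← hx, star_mulVec, ← dotProduct_mulVec, hM, smul_mulVec, hy, smul_zero, dotProduct_zero]
  rw [star_smul, smul_dotProduct, smul_eq_mul] at h
  exact (mul_eq_zero.mp h).resolve_left (star_ne_zero.mpr hk)

/-- Splitting off a term `a v vᴴ` when `A x` and `Aᴴ x` are multiples of a vector `v` that is not
orthogonal to `x`. -/
lemma exists_rank_sub_smul_vecMulVec_lt {A : Matrix m m ℂ} {x v : m → ℂ} {p q : ℂ}
    (hAx : A *ᵥ x = p • v) (hAx' : Aᴴ *ᵥ x = q • v) (hxv : star v ⬝ᵥ x ≠ 0) :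
    ∃ a : ℂ, ∀ μ : ℂ, star μ * μ = 1 → p + μ * q ≠ 0 →
      ((A - a • vecMulVec v (star v)) + μ • (A - a • vecMulVec v (star v))ᴴ).rank + 1
        ≤ (A + μ • Aᴴ).rank := by
  set k := star v ⬝ᵥ x with hk
  have hk' : star x ⬝ᵥ v = star k := by rw [hk, star_dotProduct]
  have hpq : star p * k = q * star k := by
    have h₁ : star x ⬝ᵥ (Aᴴ *ᵥ x) = q * star k := by
      rw [hAx', dotProduct_smul, hk', smul_eq_mul]
    have h₂ : star x ⬝ᵥ (Aᴴ *ᵥ x) = star p * k := by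
      rw [dotProduct_mulVec, ← star_mulVec, hAx, star_smul, smul_dotProduct, smul_eq_mul]
    rw [← h₂, h₁]
  have hsk : star k ≠ 0 := star_ne_zero.mpr hxv
  refine ⟨p / k, fun μ hμ hne => rank_add_one_le_of_ker_lt ?_⟩
  have hMx : (A + μ • Aᴴ) *ᵥ x = (p + μ * q) • v := by
    rw [add_mulVec, smul_mulVec, hAx, hAx', smul_smul, add_smul]
  have hN : ∀ y, ((A - (p / k) • vecMulVec v (star v))
      + μ • (A - (p / k) • vecMulVec v (star v))ᴴ) *ᵥ y
      = (A + μ • Aᴴ) *ᵥ y - ((p / k + μ * star (p / k)) * (star v ⬝ᵥ y)) • v := by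
    intro y
    rw [conjTranspose_sub, conjTranspose_smul, conjTranspose_vecMulVec, star_star]
    simp only [add_mulVec, sub_mulVec, smul_mulVec, vecMulVec_mulVec]
    ext i
    simp
    ring
  refine SetLike.lt_iff_le_and_exists.mpr ⟨fun y hy => ?_, x, ?_, ?_⟩
  · have hy' : (A + μ • Aᴴ) *ᵥ y = 0 := hy
    rw [LinearMap.mem_ker, mulVecLin_apply, hN, hy',
      star_dotProduct_eq_zero_of_mem_ker hμ hne hMx hy']
    simp
  · rw [LinearMap.mem_ker, mulVecLin_apply, hN, hMx, ← sub_smul, ← hk]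
    have : p + μ * q - (p / k + μ * star (p / k)) * k = 0 := by
      rw [star_div₀]
      field_simp
      linear_combination (-μ) * hpq
    rw [this, zero_smul]
  · rw [LinearMap.mem_ker, mulVecLin_apply, hMx]
    refine smul_ne_zero hne ?_
    rintro rfl
    exact hxv (by rw [hk, star_zero, zero_dotProduct])

/-- Splitting off a pair `v cᴴ + d vᴴ` when `A x` and `Aᴴ x` are multiples of a vector `v`
orthogonal to `x`. -/
lemma exists_rank_sub_vecMulVec_pair_lt {A : Matrix m m ℂ} {x v : m → ℂ} {p q : ℂ} (hv : v ≠ 0)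
    (hAx : A *ᵥ x = p • v) (hAx' : Aᴴ *ᵥ x = q • v) (hxv : star v ⬝ᵥ x = 0) :
    ∃ c d : m → ℂ, ∀ μ : ℂ, star μ * μ = 1 → p + μ * q ≠ 0 →
      ((A - (vecMulVec v (star c) + vecMulVec d (star v)))
        + μ • (A - (vecMulVec v (star c) + vecMulVec d (star v)))ᴴ).rank + 2
        ≤ (A + μ • Aᴴ).rank := by
  classical
  set k := star v ⬝ᵥ v with hk
  have hk0 : k ≠ 0 := fun h => hv (eq_zero_of_star_dotProduct_self_eq_zero h)
  have hksa : star k = k := by rw [hk, ← star_dotProduct]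
  let P : Matrix m m ℂ := 1 - k⁻¹ • vecMulVec v (star v)
  have hPH : Pᴴ = P := by
    simp only [P, conjTranspose_sub, conjTranspose_one, conjTranspose_smul,
      conjTranspose_vecMulVec, star_star, star_inv₀, hksa]
  have hP : ∀ y, P *ᵥ y = y - (k⁻¹ * (star v ⬝ᵥ y)) • v := by
    intro y
    simp only [P, sub_mulVec, one_mulVec, smul_mulVec, vecMulVec_mulVec]
    ext i
    simp
    ring
  have hPv : P *ᵥ v = 0 := by
    rw [hP, ← hk, inv_mul_cancel₀ hk0, one_smul, sub_self]
  have hPy : ∀ y, star v ⬝ᵥ y = 0 → P *ᵥ y = y := by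
    intro y hy
    rw [hP, hy, mul_zero, zero_smul, sub_zero]
  have hdec : A - (vecMulVec v (star (k⁻¹ • (Aᴴ *ᵥ v)))
      + vecMulVec (k⁻¹ • (P *ᵥ (A *ᵥ v))) (star v)) = P * A * P := by
    have h₁ : vecMulVec v (star (k⁻¹ • (Aᴴ *ᵥ v))) = (1 - P) * A := by
      simp only [P, sub_sub_cancel, star_smul, star_inv₀, hksa, star_mulVec,
        conjTranspose_conjTranspose, vecMulVec_smul, smul_mul, vecMulVec_mul]
    have h₂ : vecMulVec (k⁻¹ • (P *ᵥ (A *ᵥ v))) (star v) = P * A * (1 - P) := by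
      rw [show (1 - P) = k⁻¹ • vecMulVec v (star v) from sub_sub_cancel _ _, Matrix.mul_smul,
        mul_vecMulVec, smul_vecMulVec, mulVec_mulVec]
    rw [h₁, h₂]
    noncomm_ring
  refine ⟨k⁻¹ • (Aᴴ *ᵥ v), k⁻¹ • (P *ᵥ (A *ᵥ v)), fun μ hμ hne => ?_⟩
  have hMx : (A + μ • Aᴴ) *ᵥ x = (p + μ * q) • v := by
    rw [add_mulVec, smul_mulVec, hAx, hAx', smul_smul, add_smul]
  have hN : P * A * P + μ • (P * A * P)ᴴ = P * (A + μ • Aᴴ) * P := by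
    rw [conjTranspose_mul, conjTranspose_mul, hPH, mul_add, add_mul, Matrix.mul_smul, smul_mul,
      Matrix.mul_assoc P Aᴴ P]
  rw [hdec, hN]
  have hmem : ∀ y, y ∈ LinearMap.ker (P * (A + μ • Aᴴ) * P).mulVecLin ↔
      P *ᵥ ((A + μ • Aᴴ) *ᵥ (P *ᵥ y)) = 0 := by
    intro y
    rw [LinearMap.mem_ker, mulVecLin_apply, mulVec_mulVec, mulVec_mulVec]
  let φ : (m → ℂ) →ₗ[ℂ] ℂ := dotProductBilin ℂ ℂ (star v)
  refine rank_add_two_le_of_ker_lt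
    (W := LinearMap.ker (P * (A + μ • Aᴴ) * P).mulVecLin ⊓ LinearMap.ker φ) ?_ ?_
  · refine SetLike.lt_iff_le_and_exists.mpr ⟨fun y hy => ?_, x, Submodule.mem_inf.mpr ⟨?_, hxv⟩, ?_⟩
    · have hy' : (A + μ • Aᴴ) *ᵥ y = 0 := hy
      have hvy := star_dotProduct_eq_zero_of_mem_ker hμ hne hMx hy'
      exact ⟨(hmem y).mpr (by rw [hPy y hvy, hy', mulVec_zero]), hvy⟩
    · exact (hmem x).mpr (by rw [hPy x hxv, hMx, mulVec_smul, hPv, smul_zero])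
    · rw [LinearMap.mem_ker, mulVecLin_apply, hMx]
      exact smul_ne_zero hne hv
  · exact SetLike.lt_iff_le_and_exists.mpr
      ⟨inf_le_left, v, (hmem v).mpr (by rw [hPv, mulVec_zero, mulVec_zero]), fun h => hk0 h.2⟩

/-- If `A + μ Aᴴ` has rank at most `r` for infinitely many unimodular `μ`, then `A` decomposes. -/
lemma hasRankOneDecomposition_of_rank_le (r : ℕ) (A : Matrix m m ℂ) (T : Set ℂ)
    (hT : T.Infinite) (hunit : ∀ μ ∈ T, star μ * μ = 1)
    (hrank : ∀ μ ∈ T, (A + μ • Aᴴ).rank ≤ r) : HasRankOneDecomposition A r := by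
  induction r using Nat.strong_induction_on generalizing A T with
  | _ r ih =>
  by_cases hA : A = 0
  · exact ⟨0, 0, by omega, Fin.elim0, Fin.elim0, Fin.elim0, Fin.elim0, Fin.elim0, by simp [hA]⟩
  obtain ⟨x, v, p, q, hv, hpq, hAx, hAx'⟩ :=
    exists_mulVec_proportional_conjTranspose_mulVec A hA
  have hT' : (T \ {-p / q}).Infinite := hT.sdiff (Set.finite_singleton _)
  have hne : ∀ μ ∈ T \ {-p / q}, p + μ * q ≠ 0 := by
    rintro μ ⟨-, hμ⟩ h0
    by_cases hq : q = 0
    · simp [hq] at h0 hpq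
      exact hpq h0
    · exact hμ (by rw [Set.mem_singleton_iff, eq_div_iff hq]; linear_combination h0)
  obtain ⟨μ₀, hμ₀⟩ := hT'.nonempty
  by_cases hxv : star v ⬝ᵥ x = 0
  · obtain ⟨c, d, h⟩ := exists_rank_sub_vecMulVec_pair_lt hv hAx hAx' hxv
    have hle := fun μ (hμ : μ ∈ T \ {-p / q}) =>
      (h μ (hunit μ hμ.1) (hne μ hμ)).trans (hrank μ hμ.1)
    have h2 : 2 ≤ r := (Nat.le_add_left _ _).trans (hle μ₀ hμ₀)
    have hdec := (ih (r - 2) (by omega) _ _ hT' (fun μ hμ => hunit μ hμ.1)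
      fun μ hμ => Nat.le_sub_of_add_le (hle μ hμ)).add_vecMulVec_pair v c d
    rwa [sub_add_cancel, Nat.sub_add_cancel h2] at hdec
  · obtain ⟨a, h⟩ := exists_rank_sub_smul_vecMulVec_lt hAx hAx' hxv
    have hle := fun μ (hμ : μ ∈ T \ {-p / q}) =>
      (h μ (hunit μ hμ.1) (hne μ hμ)).trans (hrank μ hμ.1)
    have h1 : 1 ≤ r := (Nat.le_add_left _ _).trans (hle μ₀ hμ₀)
    have hdec := (ih (r - 1) (by omega) _ _ hT' (fun μ hμ => hunit μ hμ.1)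
      fun μ hμ => Nat.le_sub_of_add_le (hle μ hμ)).add_smul_vecMulVec a v
    rwa [sub_add_cancel, Nat.sub_add_cancel h1] at hdec

lemma matrix_rank_add_le (M N : Matrix m m ℂ) : (M + N).rank ≤ M.rank + N.rank := by
  rw [Matrix.rank, Matrix.rank, Matrix.rank, mulVecLin_add]
  exact (Submodule.finrank_mono (LinearMap.range_add_le _ _)).trans
    (Submodule.finrank_add_le_finrank_add_finrank _ _)

/-- A sum of matrices of rank at most `k` has rank at most the number of terms times `k`. -/
lemma rank_sum_le_card_mul {ι : Type*} (t : Finset ι) (f : ι → Matrix m m ℂ) (k : ℕ)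
    (h : ∀ i ∈ t, (f i).rank ≤ k) : (∑ i ∈ t, f i).rank ≤ t.card * k := by
  classical
  induction t using Finset.induction_on with
  | empty => simp
  | insert i t hi ih =>
    rw [Finset.sum_insert hi, Finset.card_insert_of_notMem hi]
    have h₁ := matrix_rank_add_le (f i) (∑ i ∈ t, f i)
    have h₂ := h i (Finset.mem_insert_self i t)
    have h₃ := ih fun j hj => h j (Finset.mem_insert_of_mem hj)
    linarith

lemma infinite_setOf_star_mul_self_eq_one : {μ : ℂ | star μ * μ = 1}.Infinite := by
  have hset : {μ : ℂ | star μ * μ = 1} = Metric.sphere 0 1 := by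
    ext μ
    have h : star μ * μ = ((‖μ‖ ^ 2 : ℝ) : ℂ) := by
      rw [← starRingEnd_apply, Complex.conj_mul']
      push_cast
      rfl
    rw [Set.mem_ofPred_eq, h, mem_sphere_zero_iff_norm]
    norm_cast
    exact pow_eq_one_iff_of_nonneg (norm_nonneg μ) two_ne_zero
  rw [hset]
  refine IsPreconnected.infinite_of_nontrivial
    (isPreconnected_sphere (by rw [Complex.rank_real_complex]; norm_num) _ _) ?_
  refine ⟨1, by simp, -1, by simp, ?_⟩
  norm_num

end RankOneDecomposition

/-- **Rank-1 decomposition for *-palindromic pencils.**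
If `E(λ) = A + λB` is an `n × n` *-palindromic matrix pencil (`Aᴴ = B`) of rank
`r ≤ n`, then there exist `ℓ, s` with `ℓ + 2s = r`, real numbers `a_i, b_i`, vectors
`u_i, v_j ∈ ℂ^n`, and vector pencils `w_j(λ) = c_j + λ d_j` of degree at most one
(so `rev w_j(λ) = d_j + λ c_j`) such that
`A + λB = Σ ((a_i − 𝕚 b_i) + λ(a_i + 𝕚 b_i)) u_i u_i^* + Σ (v_j w_j(λ)^* + (rev w_j)(λ) v_j^*)`. -/
theorem star_palindromic_rank_one_decomposition
    (n r : ℕ) (hrn : r ≤ n) (A B : Matrix (Fin n) (Fin n) ℂ)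
    (hAB : Aᴴ = B)
    (hrank : PencilRankEq n A B r) :
    ∃ (ℓ s : ℕ), ℓ + 2 * s = r ∧
      ∃ (a b : Fin ℓ → ℝ) (u : Fin ℓ → Fin n → ℂ)
        (v c d : Fin s → Fin n → ℂ),
        ∀ lam : ℂ,
          A + lam • B =
            (∑ i : Fin ℓ,
              (((a i : ℂ) - Complex.I * (b i : ℂ))
                + lam * ((a i : ℂ) + Complex.I * (b i : ℂ))) • vecMulVec (u i) (star (u i)))
            + ∑ j : Fin s,
                (vecMulVec (v j) (star (c j) + lam • star (d j))
                  + vecMulVec (d j + lam • c j) (star (v j))) := by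
  subst hAB
  obtain ⟨⟨μ₀, hμ₀⟩, hle⟩ := hrank
  obtain ⟨ℓ, s, hls, a, u, v, c, d, hA⟩ := hasRankOneDecomposition_of_rank_le r A _
    infinite_setOf_star_mul_self_eq_one (fun μ hμ => hμ) fun μ _ => hle μ
  have hdec : ∀ lam : ℂ, A + lam • Aᴴ =
      (∑ i : Fin ℓ, ((((a i).re : ℂ) - Complex.I * ((-(a i).im : ℝ) : ℂ))
        + lam * (((a i).re : ℂ) + Complex.I * ((-(a i).im : ℝ) : ℂ)))
          • vecMulVec (u i) (star (u i)))
      + ∑ j : Fin s, (vecMulVec (v j) (star (c j) + lam • star (d j))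
        + vecMulVec (d j + lam • c j) (star (v j))) := by
    intro lam
    have h₁ : ∀ z : ℂ, (z.re : ℂ) - Complex.I * ((-z.im : ℝ) : ℂ) = z := fun z => by
      apply Complex.ext <;> simp
    have h₂ : ∀ z : ℂ, (z.re : ℂ) + Complex.I * ((-z.im : ℝ) : ℂ) = star z := fun z => by
      apply Complex.ext <;> simp
    have hAH : Aᴴ = (∑ i, star (a i) • vecMulVec (u i) (star (u i)))
        + ∑ j, (vecMulVec (c j) (star (v j)) + vecMulVec (v j) (star (d j))) := by
      rw [hA]
      simp only [conjTranspose_add, conjTranspose_sum, conjTranspose_smul,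
        conjTranspose_vecMulVec, star_star]
    rw [hAH, hA]
    simp only [h₁, h₂, add_smul, mul_smul, vecMulVec_add, add_vecMulVec, vecMulVec_smul,
      smul_vecMulVec, Finset.sum_add_distrib, smul_add, Finset.smul_sum]
    abel
  refine ⟨ℓ, s, le_antisymm hls ?_, fun i => (a i).re, fun i => -(a i).im, u, v, c, d, hdec⟩
  rw [← hμ₀, hdec μ₀]
  refine (matrix_rank_add_le _ _).trans (add_le_add ?_ ?_)
  · refine (rank_sum_le_card_mul _ _ 1 fun i _ => ?_).trans (by simp)
    rw [← smul_vecMulVec]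
    exact rank_vecMulVec_le _ _
  · refine (rank_sum_le_card_mul _ _ 2 fun j _ => ?_).trans (by simp [mul_comm])
    exact (matrix_rank_add_le _ _).trans (add_le_add (rank_vecMulVec_le _ _) (rank_vecMulVec_le _ _))
end

section
/- Let L(λ)=A+λB be a regular n×n complex matrix pencil with pairwise distinct (finite or infinite) eigenvalues λ_1,…,λ_κ, where λ_i has partial multiplicities n_{i,1} ≥ … ≥ n_{i,g_i} > 0. Let r ≥ 1 and 0 ≤ s ≤ r, and let Φ_s : ℂ^{3rn} → (n×n pencils) be the map defined in the context. Then there exists a generic set G_s ⊆ ℂ^{3rn} such that for every x ∈ G_s, writing E = Φ_s(x): (a) L+E is a regular pencil; (b) for each i = 1,…,κ, the partial multiplicities of L+E at λ_i are exactly n_{i,r+1} ≥ … ≥ n_{i,g_i} (in particular, if r ≥ g_i then λ_i is not an eigenvalue of L+E); (c) every (finite or infinite) eigenvalue of L+E that is not an eigenvalue of L is simple. -/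
open Matrix Polynomial BigOperators

/-- The determinant of the pencil `A + λ B`, as a polynomial in `λ`. -/
noncomputable def pencilPoly (n : ℕ) (A B : Matrix (Fin n) (Fin n) ℂ) : Polynomial ℂ :=
  (A.map Polynomial.C + (Polynomial.X : Polynomial ℂ) • B.map Polynomial.C).det

/-- A pencil is regular if its determinant is not the zero polynomial. -/
def PencilRegular (n : ℕ) (A B : Matrix (Fin n) (Fin n) ℂ) : Prop :=
  pencilPoly n A B ≠ 0

/-- The order of vanishing of a polynomial at a point (`⊤` for the zero polynomial). -/
noncomputable def orderVan (p : Polynomial ℂ) (z : ℂ) : ℕ∞ :=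
  if p = 0 then ⊤ else (p.rootMultiplicity z : ℕ∞)

/-- `m_k(z)`: the minimum over all `k × k` submatrices `S(λ)` of `A + λB` of the order
of vanishing of `det S(λ)` at `z`. -/
noncomputable def minorOrder (n k : ℕ) (A B : Matrix (Fin n) (Fin n) ℂ) (z : ℂ) : ℕ∞ :=
  ⨅ (f : Fin k ↪ Fin n) (g : Fin k ↪ Fin n),
    orderVan (((A.map Polynomial.C + (Polynomial.X : Polynomial ℂ) • B.map Polynomial.C).submatrix f g).det) z

/-- The multiset of partial multiplicities of the pencil `A + λB` at the finite point
`z`: the positive values among `m_k(z) − m_{k−1}(z)`, `k = 1, …, n`. -/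
noncomputable def pmFin (n : ℕ) (A B : Matrix (Fin n) (Fin n) ℂ) (z : ℂ) : Multiset ℕ :=
  ((Multiset.range n).map fun k =>
    (minorOrder n (k + 1) A B z - minorOrder n k A B z).toNat).filter (fun m => 0 < m)

/-- The multiset of partial multiplicities of the pencil `A + λB` at a finite point
(`some z`) or at infinity (`none`, via the reversal pencil `B + λA` at `0`). -/
noncomputable def pmAt (n : ℕ) (A B : Matrix (Fin n) (Fin n) ℂ) : Option ℂ → Multiset ℕ
  | some z => pmFin n A B z
  | none => pmFin n B A 0

/-- `μ` (finite or infinite) is an eigenvalue of the pencil `A + λB` iff the list of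
partial multiplicities at `μ` is nonempty. -/
def IsEigenvalue (n : ℕ) (A B : Matrix (Fin n) (Fin n) ℂ) (μ : Option ℂ) : Prop :=
  pmAt n A B μ ≠ 0

/-- The algebraic multiplicity of a finite (`some z`) or infinite (`none`) eigenvalue. -/
noncomputable def algMultAt (n : ℕ) (A B : Matrix (Fin n) (Fin n) ℂ) : Option ℂ → ℕ
  | some z => (pencilPoly n A B).rootMultiplicity z
  | none => (pencilPoly n B A).rootMultiplicity 0

/-- A subset of `ι → ℂ` (i.e. `ℂ^N`, `N = #ι`) is generic if its complement is
contained in the common zero set of finitely many polynomials that are not all zero. -/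
def IsGenericC (ι : Type) [Fintype ι] (G : Set (ι → ℂ)) : Prop :=
  ∃ S : Finset (MvPolynomial ι ℂ), (∃ p ∈ S, p ≠ 0) ∧
    Gᶜ ⊆ { x | ∀ p ∈ S, MvPolynomial.eval x p = 0 }

/-- A subset of `ι → ℝ` (i.e. `ℝ^N`, `N = #ι`) is generic if its complement is
contained in the common zero set of finitely many real polynomials that are not all zero. -/
def IsGenericR (ι : Type) [Fintype ι] (G : Set (ι → ℝ)) : Prop :=
  ∃ S : Finset (MvPolynomial ι ℝ), (∃ p ∈ S, p ≠ 0) ∧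
    Gᶜ ⊆ { x | ∀ p ∈ S, MvPolynomial.eval x p = 0 }

/-- The parameter space `ℂ^{3rn}` for the map `Φ_s`: coordinates of the vectors
`α^{(1)},…,α^{(r)}`, `γ^{(1)},…,γ^{(r)}`, `β^{(s+1)},…,β^{(r)}` and `δ^{(1)},…,δ^{(s)}`. -/
abbrev Param13 (r s n : ℕ) : Type :=
  ((Fin r × Fin n) ⊕ (Fin r × Fin n)) ⊕ ((Fin (r - s) × Fin n) ⊕ (Fin s × Fin n))

/-- The index `s + j` in `Fin r`. -/
def idxHi {r s : ℕ} (hs : s ≤ r) (j : Fin (r - s)) : Fin r :=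
  Fin.cast (by omega) (Fin.natAdd s j)

/-- Constant coefficient of `Φ_s(x)(λ) = Σ_{i≤s} α^{(i)} (γ^{(i)} + λ δ^{(i)})ᵀ
+ Σ_{j>s} (α^{(j)} + λ β^{(j)}) (γ^{(j)})ᵀ`. -/
noncomputable def Phi13A (n r s : ℕ) (hs : s ≤ r) (x : Param13 r s n → ℂ) :
    Matrix (Fin n) (Fin n) ℂ :=
  (∑ i : Fin s,
    Matrix.vecMulVec (fun k => x (.inl (.inl (Fin.castLE hs i, k))))
      (fun k => x (.inl (.inr (Fin.castLE hs i, k)))))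
  + ∑ j : Fin (r - s),
      Matrix.vecMulVec (fun k => x (.inl (.inl (idxHi hs j, k))))
        (fun k => x (.inl (.inr (idxHi hs j, k))))

/-- Coefficient of `λ` in `Φ_s(x)(λ)`. -/
noncomputable def Phi13B (n r s : ℕ) (hs : s ≤ r) (x : Param13 r s n → ℂ) :
    Matrix (Fin n) (Fin n) ℂ :=
  (∑ i : Fin s,
    Matrix.vecMulVec (fun k => x (.inl (.inl (Fin.castLE hs i, k))))
      (fun k => x (.inr (.inr (i, k)))))
  + ∑ j : Fin (r - s),
      Matrix.vecMulVec (fun k => x (.inr (.inl (j, k))))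
        (fun k => x (.inl (.inr (idxHi hs j, k))))

/-- `q` divides every minor of size `k` of `M`. -/
def MinorsDvd {R m : Type*} [CommRing R] (q : R) (k : ℕ) (M : Matrix m m R) : Prop :=
  ∀ f g : Fin k → m, q ∣ (M.submatrix f g).det

section Minors

variable {R m : Type*} [CommRing R]

theorem MinorsDvd.transpose {q : R} {k : ℕ} {M : Matrix m m R} (h : MinorsDvd q k M) :
    MinorsDvd q k Mᵀ := fun f g => by
  rw [← det_transpose, transpose_submatrix, transpose_transpose]
  exact h g f

theorem dvd_det_add_vecMulVec {k : ℕ} {q : R} (M : Matrix (Fin (k + 1)) (Fin (k + 1)) R)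
    (u v : Fin (k + 1) → R)
    (h : ∀ i j : Fin (k + 1), q ∣ (M.submatrix i.succAbove j.succAbove).det) :
    q ∣ (M + vecMulVec u v).det := by
  classical
  have key : ∀ T : Finset (Fin (k + 1)),
      q ∣ (M + vecMulVec (fun i => if i ∈ T then u i else 0) v).det := by
    intro T
    induction T using Finset.induction_on with
    | empty =>
      have : M + vecMulVec (fun i => if i ∈ (∅ : Finset (Fin (k + 1))) then u i else 0) v = M := by
        ext i j
        simp [vecMulVec_apply]
      rw [this, det_succ_row M 0]
      exact Finset.dvd_sum fun j _ => Dvd.dvd.mul_left (h 0 j) _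
    | insert i T hi ih =>
      set N := M + vecMulVec (fun i => if i ∈ T then u i else 0) v with hN
      have hupd : M + vecMulVec (fun l => if l ∈ insert i T then u l else 0) v
          = N.updateRow i (N i + u i • v) := by
        ext a b
        by_cases ha : a = i
        · subst ha
          simp [hN, vecMulVec_apply, hi]
        · simp [hN, vecMulVec_apply, ha]
      have hrow : (N.updateRow i v).det = (M.updateRow i v).det := by
        refine det_eq_of_forall_row_eq_smul_add_const (fun l => if l ∈ T then u l else 0) i
          (by simp [hi]) fun a b => ?_
        by_cases ha : a = i
        · subst ha
          simp [hi]
        · simp [hN, vecMulVec_apply, ha]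
      rw [hupd, det_updateRow_add, det_updateRow_smul, updateRow_eq_self, hrow]
      refine dvd_add ih (Dvd.dvd.mul_left ?_ _)
      rw [det_succ_row _ i]
      refine Finset.dvd_sum fun j _ => Dvd.dvd.mul_left ?_ _
      rw [submatrix_updateRow_succAbove]
      exact h i j
  simpa using key Finset.univ

theorem MinorsDvd.add_vecMulVec {q : R} {k : ℕ} {M : Matrix m m R} (h : MinorsDvd q k M)
    (u v : m → R) : MinorsDvd q (k + 1) (M + vecMulVec u v) := fun f g =>
  dvd_det_add_vecMulVec (M.submatrix f g) (u ∘ f) (v ∘ g) fun i j =>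
    h (f ∘ i.succAbove) (g ∘ j.succAbove)

/-- Adding `r` terms of rank one shifts divisibility of minors by at most `r` sizes. -/
theorem MinorsDvd.add_sum_vecMulVec {q : R} {r : ℕ} :
    ∀ {K : ℕ} {M : Matrix m m R}, MinorsDvd q (K - r) M → ∀ u v : Fin r → m → R,
      MinorsDvd q K (M + ∑ t, vecMulVec (u t) (v t)) := by
  induction r with
  | zero => intro K M h u v; simpa using h
  | succ r ih =>
    intro K M h u v
    rcases K with _ | K
    · rw [Nat.zero_sub] at h
      intro f g
      rw [det_fin_zero]
      simpa using h Fin.elim0 Fin.elim0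
    · rw [Nat.add_sub_add_right] at h
      rw [Fin.sum_univ_castSucc, ← add_assoc]
      exact (ih h _ _).add_vecMulVec _ _

theorem MinorsDvd.mul_left [Fintype m] {q : R} {k : ℕ} {M : Matrix m m R} (h : MinorsDvd q k M)
    (P : Matrix m m R) : MinorsDvd q k (P * M) := fun f g => by
  classical
  have hrow : (P * M).submatrix f g
      = Matrix.of fun i => ∑ l, (fun i l => P (f i) l • fun j => M l (g j)) i l := by
    ext i j
    simp [Matrix.mul_apply, Finset.sum_apply]
  have : ((P * M).submatrix f g).det
      = ∑ φ : Fin k → m, (∏ i, P (f i) (φ i)) • (M.submatrix φ g).det := by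
    rw [hrow]
    change detRowAlternating.toMultilinearMap
      (fun i => ∑ l, (fun i l => P (f i) l • fun j => M l (g j)) i l) = _
    rw [MultilinearMap.map_sum]
    refine Finset.sum_congr rfl fun φ _ => ?_
    rw [MultilinearMap.map_smul_univ]
    rfl
  rw [this]
  exact Finset.dvd_sum fun φ _ => Dvd.dvd.mul_left (h φ g) _

theorem MinorsDvd.mul_right [Fintype m] {q : R} {k : ℕ} {M : Matrix m m R} (h : MinorsDvd q k M)
    (P : Matrix m m R) : MinorsDvd q k (M * P) := by
  have := (h.transpose.mul_left Pᵀ).transpose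
  rwa [transpose_mul, transpose_transpose, transpose_transpose] at this

/-- Bordering a minor not divisible by `q` by one row and one column keeps it so, after a suitable
perturbation by a constant matrix of rank one. -/
theorem exists_not_minorsDvd_succ {S : Type*} [CommRing S] (φ : S →+* R) {n k : ℕ} {q : R}
    {M : Matrix (Fin n) (Fin n) R} (h : ¬ MinorsDvd q k M) (hk : k < n) :
    ∃ α γ : Fin n → S, ¬ MinorsDvd q (k + 1) (M + (vecMulVec α γ).map φ) := by
  classical
  by_cases h0 : MinorsDvd q (k + 1) M
  swap
  · exact ⟨0, 0, by simpa using h0⟩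
  simp only [MinorsDvd, not_forall] at h
  obtain ⟨f, g, hfg⟩ := h
  have hmiss : ∀ f : Fin k → Fin n, ∃ i, ∀ t, f t ≠ i := fun f => by
    by_contra! hc
    have := Fintype.card_le_of_surjective f hc
    simp at this
    omega
  obtain ⟨i, hi⟩ := hmiss f
  obtain ⟨j, hj⟩ := hmiss g
  refine ⟨Pi.single i 1, Pi.single j 1, fun hc => hfg ?_⟩
  have h1 := hc (Fin.cons i f) (Fin.cons j g)
  have h2 := h0 (Fin.cons i f) (Fin.cons j g)
  have hdet : ((M + (vecMulVec (Pi.single i (1 : S)) (Pi.single j 1)).map φ).submatrix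
        (Fin.cons i f : Fin (k + 1) → Fin n) (Fin.cons j g : Fin (k + 1) → Fin n)).det
      = (M.submatrix (Fin.cons i f : Fin (k + 1) → Fin n)
          (Fin.cons j g : Fin (k + 1) → Fin n)).det + (M.submatrix f g).det := by
    rw [det_succ_row_zero, det_succ_row_zero, Fin.sum_univ_succ, Fin.sum_univ_succ]
    have hsub : ∀ t : Fin (k + 1),
        ((M + (vecMulVec (Pi.single i (1 : S)) (Pi.single j 1)).map φ).submatrix
          (Fin.cons i f : Fin (k + 1) → Fin n) (Fin.cons j g : Fin (k + 1) → Fin n)).submatrix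
            Fin.succ t.succAbove
        = (M.submatrix (Fin.cons i f : Fin (k + 1) → Fin n)
          (Fin.cons j g : Fin (k + 1) → Fin n)).submatrix Fin.succ t.succAbove := by
      intro t
      ext a b
      simp [vecMulVec_apply, Pi.single_eq_of_ne (hi a)]
    have hz : (M.submatrix (Fin.cons i f : Fin (k + 1) → Fin n)
          (Fin.cons j g : Fin (k + 1) → Fin n)).submatrix Fin.succ (Fin.succAbove 0)
        = M.submatrix f g := by
      ext a b
      simp
    simp only [hsub, hz]
    simp [vecMulVec_apply, Pi.single_eq_of_ne (hj _)]
    ring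
  rw [hdet] at h1
  exact (dvd_add_right h2).mp h1

theorem exists_not_minorsDvd {S : Type*} [CommRing S] (φ : S →+* R) {n r : ℕ} {q : R} :
    ∀ {K : ℕ} {M : Matrix (Fin n) (Fin n) R}, ¬ MinorsDvd q (K - r) M → K ≤ n →
      ∃ α γ : Fin r → Fin n → S,
        ¬ MinorsDvd q K (M + (∑ t, vecMulVec (α t) (γ t)).map φ) := by
  induction r with
  | zero => intro K M h _; exact ⟨0, 0, by simpa using h⟩
  | succ r ih =>
    intro K M h hK
    rcases K with _ | K
    · exact ⟨0, 0, by simpa using h⟩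
    · rw [Nat.add_sub_add_right] at h
      obtain ⟨α, γ, h1⟩ := ih h (by omega)
      obtain ⟨a, c, h2⟩ := exists_not_minorsDvd_succ φ h1 (by omega)
      refine ⟨Fin.snoc α a, Fin.snoc γ c, ?_⟩
      rw [Fin.sum_univ_castSucc, Matrix.map_add φ (map_add φ), ← add_assoc]
      simpa using h2

end Minors

section MinorOrder

/-- The pencil `A + λ B` as a matrix of polynomials. -/
noncomputable abbrev pencil {R m : Type*} [CommRing R] (A B : Matrix m m R) : Matrix m m R[X] :=
  A.map Polynomial.C + (Polynomial.X : R[X]) • B.map Polynomial.C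

theorem natCast_le_orderVan {p : ℂ[X]} {z : ℂ} {a : ℕ} :
    (a : ℕ∞) ≤ orderVan p z ↔ (X - C z) ^ a ∣ p := by
  unfold orderVan
  split_ifs with h
  · simp [h]
  · rw [Nat.cast_le, le_rootMultiplicity_iff h]

theorem natCast_le_minorOrder {n k a : ℕ} {A B : Matrix (Fin n) (Fin n) ℂ} {z : ℂ} :
    (a : ℕ∞) ≤ minorOrder n k A B z ↔ MinorsDvd ((X - C z) ^ a) k (pencil A B) := by
  unfold minorOrder MinorsDvd
  simp only [le_iInf_iff, natCast_le_orderVan]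
  refine ⟨fun h f g => ?_, fun h f g => h f g⟩
  by_cases hf : Function.Injective f
  · by_cases hg : Function.Injective g
    · exact h ⟨f, hf⟩ ⟨g, hg⟩
    · simp only [Function.Injective, not_forall] at hg
      obtain ⟨i, j, hij, hne⟩ := hg
      rw [det_zero_of_column_eq hne fun l => by simp [hij]]
      exact dvd_zero _
  · simp only [Function.Injective, not_forall] at hf
    obtain ⟨i, j, hij, hne⟩ := hf
    rw [det_zero_of_row_eq hne (by ext l; simp [hij])]
    exact dvd_zero _

theorem minorOrder_eq_natCast {n k a : ℕ} {A B : Matrix (Fin n) (Fin n) ℂ} {z : ℂ}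
    (h₁ : MinorsDvd ((X - C z) ^ a) k (pencil A B))
    (h₂ : ¬ MinorsDvd ((X - C z) ^ (a + 1)) k (pencil A B)) :
    minorOrder n k A B z = a := by
  refine le_antisymm ?_ (natCast_le_minorOrder.mpr h₁)
  rw [← natCast_le_minorOrder, not_le, Nat.cast_add, Nat.cast_one] at h₂
  exact Order.le_of_lt_add_one h₂

/-- A nonsingular matrix over a principal ideal domain is equivalent to a diagonal one. -/
theorem exists_equivalent_diagonal {R m : Type*} [CommRing R] [IsDomain R] [IsPrincipalIdealRing R]
    [Fintype m] [DecidableEq m] (M : Matrix m m R) (hM : M.det ≠ 0) :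
    ∃ (U U' W W' : Matrix m m R) (a : m → R), U' * U = 1 ∧ W * W' = 1 ∧
      M = U * diagonal a * W := by
  classical
  have hinj : Function.Injective M.mulVecLin := by
    rw [← LinearMap.ker_eq_bot, LinearMap.ker_eq_bot']
    exact fun v hv => eq_zero_of_mulVec_eq_zero hM hv
  set N := LinearMap.range M.mulVecLin
  have hN : Module.finrank R N = Module.finrank R (m → R) :=
    LinearMap.finrank_range_of_inj hinj
  obtain ⟨b, a, c, hc⟩ := Submodule.exists_smith_normal_form_of_rank_eq (Pi.basisFun R m) hN
  let e := LinearEquiv.ofInjective M.mulVecLin hinj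
  let d : Module.Basis m R N := (Pi.basisFun R m).map e
  refine ⟨(Pi.basisFun R m).toMatrix b, b.toMatrix (Pi.basisFun R m), c.toMatrix d, d.toMatrix c, a,
    Module.Basis.toMatrix_mul_toMatrix_flip _ _, Module.Basis.toMatrix_mul_toMatrix_flip _ _, ?_⟩
  ext i j
  have hd : ((d j : N) : m → R) i = M i j := by
    have : ((d j : N) : m → R) = M.mulVecLin (Pi.basisFun R m j) := by
      rw [Module.Basis.map_apply]
      exact LinearEquiv.ofInjective_apply _ _
    rw [this]
    simp
  rw [← hd, ← c.sum_repr (d j)]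
  simp only [Submodule.coe_sum, Submodule.coe_smul, hc, Finset.sum_apply, Pi.smul_apply,
    smul_eq_mul, Matrix.mul_apply (M := _ * _), mul_diagonal]
  refine Finset.sum_congr rfl fun l _ => ?_
  simp [Module.Basis.toMatrix_apply]
  ring

theorem sum_range_le_sum_of_injective {n k : ℕ} {e : ℕ → ℕ}
    (he : ∀ i j, i ≤ j → j < n → e i ≤ e j) (g : Fin k → Fin n) (hg : Function.Injective g) :
    ∑ i ∈ Finset.range k, e i ≤ ∑ i, e (g i) := by
  classical
  have hcard : (Finset.univ.image g).card = k := by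
    rw [Finset.card_image_of_injective _ hg, Finset.card_univ, Fintype.card_fin]
  set o := (Finset.univ.image g).orderEmbOfFin hcard with ho
  have hsum : ∑ i, e (g i) = ∑ i, e (o i) := by
    rw [← Finset.sum_image (f := fun x : Fin n => e x) (fun a _ b _ h => hg h),
      ← Finset.sum_image (f := fun x : Fin n => e x) (fun a _ b _ h => o.injective h)]
    congr 1
    ext x
    rw [ho, Finset.image_orderEmbOfFin_univ]
  have hle : ∀ (t : ℕ) (ht : t < k), t ≤ (o ⟨t, ht⟩ : ℕ) := by
    intro t
    induction t with
    | zero => simp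
    | succ t ih =>
      intro ht
      have h1 := ih (by omega)
      have h2 : o ⟨t, by omega⟩ < o ⟨t + 1, ht⟩ := o.strictMono (by simp [Fin.lt_def])
      rw [Fin.lt_def] at h2
      omega
  rw [hsum, Finset.sum_range]
  exact Finset.sum_le_sum fun i _ => he _ _ (hle i i.2) (o i).2

theorem MinorsDvd.diagonal {R : Type*} [CommRing R] {n k : ℕ} {q : R} {a : Fin n → R} {e : ℕ → ℕ}
    (he : ∀ i j, i ≤ j → j < n → e i ≤ e j) (ha : ∀ i : Fin n, q ^ e i ∣ a i) :
    MinorsDvd (q ^ ∑ i ∈ Finset.range k, e i) k (Matrix.diagonal a) := fun f g => by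
  by_cases hg : Function.Injective g
  swap
  · simp only [Function.Injective, not_forall] at hg
    obtain ⟨i, j, hij, hne⟩ := hg
    rw [det_zero_of_column_eq hne fun l => by simp [hij]]
    exact dvd_zero _
  rw [det_apply]
  refine Finset.dvd_sum fun σ _ => ?_
  rw [Units.smul_def, zsmul_eq_mul]
  refine Dvd.dvd.mul_left ((pow_dvd_pow q (sum_range_le_sum_of_injective he g hg)).trans ?_) _
  rw [← Finset.prod_pow_eq_pow_sum]
  refine Finset.prod_dvd_prod_of_dvd _ _ fun i _ => ?_
  rw [submatrix_apply, diagonal_apply]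
  split_ifs with h
  · rw [h]
    exact ha (g i)
  · exact dvd_zero _

/-- The orders of vanishing of the minors of a regular pencil are the partial sums of a
nondecreasing sequence. -/
theorem exists_minorOrder_eq_sum {n : ℕ} {A B : Matrix (Fin n) (Fin n) ℂ}
    (h : PencilRegular n A B) (z : ℂ) :
    ∃ e : ℕ → ℕ, (∀ i j, i ≤ j → j < n → e i ≤ e j) ∧
      ∀ k ≤ n, minorOrder n k A B z = (∑ i ∈ Finset.range k, e i : ℕ) := by
  obtain ⟨U, U', W, W', a, hU, hW, hM⟩ := exists_equivalent_diagonal (pencil A B) h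
  have hdiag : ∀ q k, MinorsDvd q k (pencil A B) ↔ MinorsDvd q k (Matrix.diagonal a) := by
    refine fun q k => ⟨fun hq => ?_, fun hq => ?_⟩
    · have := (hq.mul_left U').mul_right W'
      rwa [hM, Matrix.mul_assoc U, ← Matrix.mul_assoc U', hU, Matrix.one_mul, Matrix.mul_assoc, hW,
        Matrix.mul_one] at this
    · rw [hM]
      exact (hq.mul_left U).mul_right W
  have ha : ∀ i, a i ≠ 0 := fun i hi => h <| by
    change (pencil A B).det = 0
    rw [hM, det_mul, det_mul, det_diagonal, Finset.prod_eq_zero (Finset.mem_univ i) hi]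
    ring
  set o : Fin n → ℕ := fun i => (a i).rootMultiplicity z
  set σ := Tuple.sort o
  have hmono : Monotone (o ∘ σ) := Tuple.monotone_sort o
  set e : ℕ → ℕ := fun i => if hi : i < n then o (σ ⟨i, hi⟩) else 0
  have heσ : ∀ i : Fin n, e i = o (σ i) := fun i => by simp [e]
  have he : ∀ i j, i ≤ j → j < n → e i ≤ e j := fun i j hij hj => by
    simp only [e, hj, hij.trans_lt hj, dif_pos]
    exact hmono (Fin.mk_le_mk.mpr hij)
  have hperm : ∀ q k, MinorsDvd q k (Matrix.diagonal a)
      ↔ MinorsDvd q k (Matrix.diagonal (a ∘ σ)) := by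
    intro q k
    rw [← submatrix_diagonal_equiv a σ]
    refine ⟨fun hq f g => hq (σ ∘ f) (σ ∘ g), fun hq f g => ?_⟩
    have := hq (σ.symm ∘ f) (σ.symm ∘ g)
    rwa [submatrix_submatrix, ← Function.comp_assoc, ← Function.comp_assoc, σ.self_comp_symm]
      at this
  refine ⟨e, he, fun k hk => minorOrder_eq_natCast ?_ fun hc => ?_⟩
  · rw [hdiag, hperm]
    refine MinorsDvd.diagonal he fun i => ?_
    rw [heσ]
    exact pow_rootMultiplicity_dvd _ _
  · rw [hdiag, hperm] at hc
    have hb : ∀ i, ((a ∘ σ) ∘ Fin.castLE hk) i ≠ 0 := fun i => ha _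
    have := hc (Fin.castLE hk) (Fin.castLE hk)
    rw [submatrix_diagonal _ _ (Fin.castLE_injective hk), det_diagonal,
      ← le_rootMultiplicity_iff (Finset.prod_ne_zero_iff.mpr fun i _ => hb i)] at this
    have hprod : ∀ (s : Finset (Fin k)) (b : Fin k → ℂ[X]), (∀ i, b i ≠ 0) →
        (∏ i ∈ s, b i).rootMultiplicity z = ∑ i ∈ s, (b i).rootMultiplicity z := by
      classical
      intro s b hb
      induction s using Finset.induction_on with
      | empty => simp
      | insert i s hi ih =>
        rw [Finset.prod_insert hi, Finset.sum_insert hi, rootMultiplicity_mul, ih]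
        exact mul_ne_zero (hb i) (Finset.prod_ne_zero_iff.mpr fun i _ => hb i)
    rw [hprod _ _ hb, Finset.sum_range] at this
    have hs : ∀ i : Fin k, e i
        = (((a ∘ σ) ∘ Fin.castLE hk) i).rootMultiplicity z := fun i => heσ (Fin.castLE hk i)
    simp only [hs] at this
    omega

end MinorOrder

section PartialMultiplicities

theorem Multiset.map_range_reflect {α : Type*} (n : ℕ) (f : ℕ → α) :
    (Multiset.range n).map (fun j => f (n - 1 - j)) = (Multiset.range n).map f := by
  have : (Multiset.range n).map (fun j => n - 1 - j) = Multiset.range n := by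
    rw [← Multiset.coe_range, Multiset.map_coe, Multiset.coe_eq_coe]
    refine (List.perm_ext_iff_of_nodup ?_ List.nodup_range).mpr fun a => ?_
    · refine List.Nodup.map_on (fun x hx y hy h => ?_) List.nodup_range
      rw [List.mem_range] at hx hy
      omega
    · simp only [List.mem_map, List.mem_range]
      exact ⟨fun ⟨j, hj, h⟩ => by omega, fun h => ⟨n - 1 - a, by omega, by omega⟩⟩
  conv_rhs => rw [← this, Multiset.map_map]
  rfl

/-- Two multisets of natural numbers with the same size and the same positive elements agree. -/
theorem Multiset.eq_of_filter_pos_eq {s t : Multiset ℕ} (hcard : s.card = t.card)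
    (h : s.filter (fun m => 0 < m) = t.filter (fun m => 0 < m)) : s = t := by
  have hzero : ∀ u : Multiset ℕ, u.filter (fun m => ¬ 0 < m)
      = Multiset.replicate (u.filter (fun m => ¬ 0 < m)).card 0 := fun u =>
    Multiset.eq_replicate_card.mpr fun b hb => by
      have := (Multiset.mem_filter.mp hb).2
      omega
  have hs := Multiset.filter_add_not (fun m => 0 < m) s
  have ht := Multiset.filter_add_not (fun m => 0 < m) t
  have hc : (s.filter (fun m => ¬ 0 < m)).card = (t.filter (fun m => ¬ 0 < m)).card := by
    have h1 := congrArg Multiset.card hs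
    have h2 := congrArg Multiset.card ht
    rw [Multiset.card_add] at h1 h2
    rw [h] at h1
    omega
  rw [← hs, ← ht, h, hzero s, hzero t, hc]

theorem filter_pos_map_range {nn : ℕ → ℕ} {g N : ℕ} (hgpos : ∀ j, 0 < nn j ↔ j < g) (r : ℕ)
    (hN : g - r ≤ N) :
    ((Multiset.range N).map fun j => nn (r + j)).filter (fun m => 0 < m)
      = (Multiset.range (g - r)).map fun j => nn (r + j) := by
  rw [Multiset.filter_map]
  congr 1
  refine Multiset.Nodup.ext ((Multiset.nodup_range N).filter _) (Multiset.nodup_range _) |>.mpr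
    fun a => ?_
  simp only [Multiset.mem_filter, Multiset.mem_range, Function.comp_apply, hgpos]
  omega

/-- Shifting a nondecreasing sequence removes the `r` largest of its positive values. -/
theorem filter_pos_shift {n g r : ℕ} {e nn : ℕ → ℕ}
    (he : ∀ i j, i ≤ j → j < n → e i ≤ e j)
    (hmono : ∀ j k : ℕ, j ≤ k → nn k ≤ nn j) (hgpos : ∀ j : ℕ, 0 < nn j ↔ j < g)
    (hpm : ((Multiset.range n).map e).filter (fun m => 0 < m) = (Multiset.range g).map nn) :
    ((Multiset.range n).map fun k => if k < r then 0 else e (k - r)).filter (fun m => 0 < m)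
      = (Multiset.range (g - r)).map fun j => nn (r + j) := by
  have hgn : g ≤ n := by
    have h1 := congrArg Multiset.card hpm
    have h2 := Multiset.card_le_card
      (Multiset.filter_le (fun m => 0 < m) ((Multiset.range n).map e))
    simp only [Multiset.card_map, Multiset.card_range] at h1 h2
    omega
  have hnn : ∀ j < n, e (n - 1 - j) = nn j := by
    have hms : (Multiset.range n).map (fun j => e (n - 1 - j)) = (Multiset.range n).map nn := by
      rw [Multiset.map_range_reflect]
      refine Multiset.eq_of_filter_pos_eq (by simp) ?_
      have := filter_pos_map_range hgpos 0 (N := n) (by omega)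
      simp only [zero_add, Nat.sub_zero] at this
      rw [hpm, this]
    rw [← Multiset.coe_range, Multiset.map_coe, Multiset.map_coe, Multiset.coe_eq_coe] at hms
    have hsorted : ∀ f : ℕ → ℕ, (∀ i j, i ≤ j → j < n → f j ≤ f i) →
        ((List.range n).map f).Pairwise (fun a b => b ≤ a) := fun f hf => by
      rw [List.pairwise_map]
      refine List.pairwise_lt_range.imp_of_mem fun _ hb hab => ?_
      exact hf _ _ hab.le (List.mem_range.mp hb)
    have heq := hms.eq_of_pairwise (le := fun a b => b ≤ a) (fun a b _ _ h1 h2 => le_antisymm h2 h1)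
      (hsorted _ fun i j hij hj => he _ _ (by omega) (by omega))
      (hsorted _ fun i j hij _ => hmono i j hij)
    intro j hj
    exact List.map_inj_left.mp heq j (List.mem_range.mpr hj)
  rw [← filter_pos_map_range hgpos r (N := n) (by omega), ← Multiset.map_range_reflect]
  congr 1
  refine Multiset.map_congr rfl fun j hj => ?_
  rw [Multiset.mem_range] at hj
  split_ifs with h
  · have := (hgpos (r + j)).not.mpr (by omega)
    omega
  · rw [← hnn (r + j) (by omega)]
    congr 1
    omega

theorem pmFin_eq_of_sum {n : ℕ} {A B : Matrix (Fin n) (Fin n) ℂ} {z : ℂ} {e : ℕ → ℕ}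
    (h : ∀ k ≤ n, minorOrder n k A B z = (∑ i ∈ Finset.range k, e i : ℕ)) :
    pmFin n A B z = ((Multiset.range n).map e).filter (fun m => 0 < m) := by
  unfold pmFin
  congr 1
  refine Multiset.map_congr rfl fun k hk => ?_
  rw [Multiset.mem_range] at hk
  rw [h k hk.le, h (k + 1) hk, ← ENat.natCast_sub, ENat.toNat_natCast, Finset.sum_range_succ,
    Nat.add_sub_cancel_left]

/-- If the orders of the minors are shifted by `r`, the `r` largest partial multiplicities
disappear. -/
theorem pmFin_of_minorOrder_shift {n g r : ℕ} {A B A' B' : Matrix (Fin n) (Fin n) ℂ} {z : ℂ}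
    {nn : ℕ → ℕ} (hreg : PencilRegular n A B)
    (hshift : ∀ k ≤ n, minorOrder n k A' B' z = minorOrder n (k - r) A B z)
    (hmono : ∀ j k : ℕ, j ≤ k → nn k ≤ nn j) (hgpos : ∀ j : ℕ, 0 < nn j ↔ j < g)
    (hpm : pmFin n A B z = (Multiset.range g).map nn) :
    pmFin n A' B' z = (Multiset.range (g - r)).map fun j => nn (r + j) := by
  obtain ⟨e, he, hsum⟩ := exists_minorOrder_eq_sum hreg z
  rw [pmFin_eq_of_sum hsum] at hpm
  rw [← filter_pos_shift he hmono hgpos hpm]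
  refine pmFin_eq_of_sum fun k hk => ?_
  rw [hshift k hk, hsum _ (by omega), Nat.cast_inj]
  clear hk
  induction k with
  | zero => simp
  | succ k ih =>
    rw [Finset.sum_range_succ, ← ih]
    split_ifs with h
    · rw [Nat.sub_eq_zero_of_le h, Nat.sub_eq_zero_of_le h.le, add_zero]
    · rw [Nat.succ_sub (by omega), Finset.sum_range_succ]

/-- For a regular pencil, `z` is an eigenvalue if and only if the determinant vanishes there. -/
theorem pmFin_eq_zero_iff {n : ℕ} {A B : Matrix (Fin n) (Fin n) ℂ} {z : ℂ}
    (hreg : PencilRegular n A B) : pmFin n A B z = 0 ↔ (pencilPoly n A B).eval z ≠ 0 := by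
  obtain ⟨e, he, hsum⟩ := exists_minorOrder_eq_sum hreg z
  have hdet : MinorsDvd (X - C z) n (pencil A B) ↔ (pencilPoly n A B).eval z = 0 := by
    rw [← IsRoot.def, ← dvd_iff_isRoot]
    refine ⟨fun h => h id id, fun h f g => ?_⟩
    have h1 : (pencil A B).submatrix f g
        = (1 : Matrix _ _ ℂ[X]).submatrix f id * pencil A B
          * (1 : Matrix _ _ ℂ[X]).submatrix id g := by
      ext i j
      simp [Matrix.mul_apply, Matrix.one_apply]
    rw [h1, det_mul, det_mul]
    exact Dvd.dvd.mul_right (Dvd.dvd.mul_left h _) _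
  have := natCast_le_minorOrder (n := n) (k := n) (a := 1) (A := A) (B := B) (z := z)
  rw [pow_one, hdet, hsum n le_rfl, Nat.cast_le] at this
  rw [Ne, ← this, pmFin_eq_of_sum hsum, Multiset.filter_eq_nil]
  simp [Nat.one_le_iff_ne_zero, Finset.sum_eq_zero_iff]

end PartialMultiplicities

section RepeatedFactors

theorem Polynomial.sq_dvd_of_prime_dvd_derivative {K : Type*} [Field K] [CharZero K] {p f : K[X]}
    (hp : Prime p) (h : p ∣ f) (h' : p ∣ derivative f) : p * p ∣ f := by
  obtain ⟨q, rfl⟩ := h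
  refine mul_dvd_mul_left p ?_
  rw [derivative_mul] at h'
  have h1 : p ∣ derivative p * q := (dvd_add_left (dvd_mul_right p _)).mp h'
  refine (hp.dvd_or_dvd h1).resolve_left fun hd => ?_
  have hdeg : 0 < p.natDegree := hp.irreducible.natDegree_pos
  have hne : derivative p ≠ 0 := fun h0 => by
    have := derivative_eq_zero.mp h0
    omega
  exact absurd (natDegree_le_of_dvd hd hne) (not_le.mpr (natDegree_derivative_lt hdeg.ne'))

/-- If all repeated factors of `F` divide `N`, then up to a constant of `R` some power of `N` lies in
the ideal generated by `F` and its derivative. -/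
theorem Polynomial.exists_C_mul_pow_eq_of_repeated_factors {R : Type*} [CommRing R] [IsDomain R]
    [UniqueFactorizationMonoid R] [CharZero R] {F N : R[X]} (hF : F ≠ 0)
    (h : ∀ p : R[X], p * p ∣ F → p ∣ N) :
    ∃ (c : R) (m : ℕ) (a b : R[X]), c ≠ 0 ∧ C c * N ^ m = a * F + b * derivative F := by
  classical
  let : NormalizedGCDMonoid R := Classical.arbitrary _
  let K := FractionRing R
  let φ : R →+* K := algebraMap R K
  have hφ : Function.Injective φ := IsFractionRing.injective R K
  have : CharZero K := charZero_of_injective_algebraMap hφ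
  set I : Ideal K[X] := Ideal.span {F.map φ, derivative (F.map φ)}
  have hrad : N.map φ ∈ I.radical := by
    rw [Ideal.radical_eq_sInf, Submodule.mem_sInf]
    rintro P ⟨hIP, hP⟩
    have hFP : F.map φ ∈ P := hIP (Ideal.subset_span (by simp))
    have hFP' : derivative (F.map φ) ∈ P := hIP (Ideal.subset_span (by simp))
    obtain ⟨p, rfl⟩ := (IsPrincipalIdealRing.principal P).principal
    change _ ∈ Ideal.span {p} at hFP
    change _ ∈ Ideal.span {p} at hFP'
    change _ ∈ Ideal.span {p}
    rw [Ideal.mem_span_singleton] at hFP hFP' ⊢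
    have hp0 : p ≠ 0 := by
      rintro rfl
      rw [zero_dvd_iff, Polynomial.map_eq_zero_iff hφ] at hFP
      exact hF hFP
    have hp : Prime p := (Ideal.span_singleton_prime hp0).mp hP
    have hsq := Polynomial.sq_dvd_of_prime_dvd_derivative hp hFP hFP'
    set w := IsLocalization.integerNormalization (nonZeroDivisors R) p with hw
    obtain ⟨b, hb, hbw⟩ := IsLocalization.integerNormalization_spec (nonZeroDivisors R) p
    rw [← hw] at hbw
    have hb0 : φ b ≠ 0 := (map_ne_zero_iff φ hφ).mpr (nonZeroDivisors.ne_zero hb)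
    have hw0 : w ≠ 0 := by
      intro h0
      rw [h0, Polynomial.map_zero, Algebra.smul_def] at hbw
      exact mul_ne_zero (C_ne_zero.mpr hb0) hp0 hbw.symm
    have hassoc : Associated (w.primPart.map φ) p := by
      have h1 : w.map φ = C (φ w.content) * w.primPart.map φ := by
        conv_lhs => rw [w.eq_C_content_mul_primPart]
        rw [Polynomial.map_mul, map_C]
      have hc0 : φ w.content ≠ 0 :=
        (map_ne_zero_iff φ hφ).mpr (content_eq_zero_iff.not.mpr hw0)
      have h2 : C (φ w.content) * w.primPart.map φ = C (φ b) * p := by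
        rw [← h1]
        change w.map (algebraMap R K) = _
        rw [hbw, Algebra.smul_def]
        rfl
      have hu1 : IsUnit (C (φ w.content)) := isUnit_C.mpr hc0.isUnit
      have hu2 : IsUnit (C (φ b)) := isUnit_C.mpr hb0.isUnit
      exact ((associated_isUnit_mul_left_iff hu1).mp
        (h2 ▸ (associated_isUnit_mul_left_iff hu2).mpr (Associated.refl p)) :)
    have hprim := w.isPrimitive_primPart
    have hdvd : w.primPart * w.primPart ∣ F := by
      refine (hprim.mul hprim).dvd_of_fraction_map_dvd_fraction_map (K := K) ?_
      rw [Polynomial.map_mul]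
      exact (hassoc.mul_mul hassoc).dvd.trans hsq
    exact hassoc.symm.dvd.trans (Polynomial.map_dvd φ (h _ hdvd))
  obtain ⟨m, hm⟩ := hrad
  obtain ⟨a, b, hab⟩ := Ideal.mem_span_pair.mp hm
  obtain ⟨ca, hca, ha⟩ := IsLocalization.integerNormalization_spec (nonZeroDivisors R) a
  obtain ⟨cb, hcb, hb⟩ := IsLocalization.integerNormalization_spec (nonZeroDivisors R) b
  refine ⟨ca * cb, m, C cb * IsLocalization.integerNormalization (nonZeroDivisors R) a,
    C ca * IsLocalization.integerNormalization (nonZeroDivisors R) b,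
    mul_ne_zero (nonZeroDivisors.ne_zero hca) (nonZeroDivisors.ne_zero hcb), ?_⟩
  refine Polynomial.map_injective φ hφ ?_
  simp only [Polynomial.map_mul, Polynomial.map_add, Polynomial.map_pow, map_C, map_mul]
  change _ = C (φ cb) * Polynomial.map (algebraMap R K) _ * _
    + C (φ ca) * Polynomial.map (algebraMap R K) _ * _
  rw [ha, hb, ← derivative_map, ← hab, Algebra.smul_def, Algebra.smul_def]
  change _ = C (φ cb) * (C (φ ca) * a) * _ + C (φ ca) * (C (φ cb) * b) * _
  ring

end RepeatedFactors

section Generic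

variable {ι : Type}

/-- A property holds generically if it holds off the zero set of some nonzero polynomial. -/
def HoldsGenerically (P : (ι → ℂ) → Prop) : Prop :=
  ∃ p : MvPolynomial ι ℂ, p ≠ 0 ∧ ∀ x, MvPolynomial.eval x p ≠ 0 → P x

theorem HoldsGenerically.mono {P Q : (ι → ℂ) → Prop} (hP : HoldsGenerically P)
    (h : ∀ x, P x → Q x) : HoldsGenerically Q :=
  let ⟨p, hp, hx⟩ := hP
  ⟨p, hp, fun x hpx => h x (hx x hpx)⟩

theorem HoldsGenerically.and {P Q : (ι → ℂ) → Prop} (hP : HoldsGenerically P)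
    (hQ : HoldsGenerically Q) : HoldsGenerically fun x => P x ∧ Q x := by
  obtain ⟨p, hp, hpx⟩ := hP
  obtain ⟨q, hq, hqx⟩ := hQ
  refine ⟨p * q, mul_ne_zero hp hq, fun x hx => ?_⟩
  rw [map_mul] at hx
  exact ⟨hpx x (left_ne_zero_of_mul hx), hqx x (right_ne_zero_of_mul hx)⟩

theorem HoldsGenerically.forall {κ : Type*} [Finite κ] {P : κ → (ι → ℂ) → Prop}
    (h : ∀ i, HoldsGenerically (P i)) : HoldsGenerically fun x => ∀ i, P i x := by
  cases nonempty_fintype κ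
  choose p hp hpx using h
  refine ⟨∏ i, p i, Finset.prod_ne_zero_iff.mpr fun i _ => hp i, fun x hx i => hpx i x ?_⟩
  rw [map_prod] at hx
  exact Finset.prod_ne_zero_iff.mp hx i (Finset.mem_univ i)

theorem HoldsGenerically.isGenericC [Fintype ι] {P : (ι → ℂ) → Prop} (h : HoldsGenerically P) :
    IsGenericC ι {x | P x} := by
  obtain ⟨p, hp, hpx⟩ := h
  refine ⟨{p}, ⟨p, by simp, hp⟩, fun x hx q hq => ?_⟩
  rw [Finset.mem_singleton.mp hq]
  by_contra hne
  exact hx (hpx x hne)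

theorem map_C_map_eval (x : ι → ℂ) (q : ℂ[X]) :
    (q.map MvPolynomial.C).map (MvPolynomial.eval x) = q := by
  have hid : (MvPolynomial.eval x).comp MvPolynomial.C = RingHom.id ℂ := by
    ext
    simp
  rw [Polynomial.map_map, hid, Polynomial.map_id]

theorem holdsGenerically_map_ne_zero {F : (MvPolynomial ι ℂ)[X]} (x₀ : ι → ℂ)
    (h : F.map (MvPolynomial.eval x₀) ≠ 0) :
    HoldsGenerically fun x => F.map (MvPolynomial.eval x) ≠ 0 := by
  obtain ⟨j, hj⟩ : ∃ j, (F.map (MvPolynomial.eval x₀)).coeff j ≠ 0 := by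
    by_contra! hc
    exact h (Polynomial.ext hc)
  rw [coeff_map] at hj
  refine ⟨F.coeff j, fun h0 => hj (by rw [h0, map_zero]), fun x hx h0 => hx ?_⟩
  rw [← coeff_map, h0, coeff_zero]

theorem holdsGenerically_not_dvd {F : (MvPolynomial ι ℂ)[X]} {q : ℂ[X]} (hq : q.Monic)
    (x₀ : ι → ℂ) (h : ¬ q ∣ F.map (MvPolynomial.eval x₀)) :
    HoldsGenerically fun x => ¬ q ∣ F.map (MvPolynomial.eval x) := by
  have hmap : ∀ x : ι → ℂ, (F %ₘ q.map MvPolynomial.C).map (MvPolynomial.eval x)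
      = F.map (MvPolynomial.eval x) %ₘ q := fun x => by
    rw [map_modByMonic _ (hq.map _), map_C_map_eval]
  simp only [← modByMonic_eq_zero_iff_dvd hq, ← hmap] at h ⊢
  exact holdsGenerically_map_ne_zero x₀ h

end Generic

section Family

variable {ι : Type} {n r : ℕ}

/-- The pencils `PA + λ PB` with polynomial parameters have rank at most `r`, every constant matrix
of rank at most `r` occurs among them, and every parameter enters linearly in one row or in one
column only. -/
structure LowRankFamily (r : ℕ) (PA PB : Matrix (Fin n) (Fin n) (MvPolynomial ι ℂ)) : Prop where
  decomp : ∀ x : ι → ℂ, ∃ u v : Fin r → Fin n → ℂ[X],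
    pencil (PA.map (MvPolynomial.eval x)) (PB.map (MvPolynomial.eval x))
      = ∑ t, vecMulVec (u t) (v t)
  attain : ∀ α γ : Fin r → Fin n → ℂ, ∃ x : ι → ℂ,
    PA.map (MvPolynomial.eval x) = ∑ t, vecMulVec (α t) (γ t) ∧ PB.map (MvPolynomial.eval x) = 0
  degree : ∀ c : ι,
    (∃ k, ∀ i j, (PA i j).degreeOf c ≤ (if i = k then 1 else 0)
      ∧ (PB i j).degreeOf c ≤ (if i = k then 1 else 0)) ∨
    (∃ k, ∀ i j, (PA i j).degreeOf c ≤ (if j = k then 1 else 0)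
      ∧ (PB i j).degreeOf c ≤ (if j = k then 1 else 0))

/-- The pencil `(A + PA) + λ (B + PB)` with polynomial parameters. -/
noncomputable def familyPencil (A B : Matrix (Fin n) (Fin n) ℂ)
    (PA PB : Matrix (Fin n) (Fin n) (MvPolynomial ι ℂ)) :
    Matrix (Fin n) (Fin n) (MvPolynomial ι ℂ)[X] :=
  pencil (A.map MvPolynomial.C + PA) (B.map MvPolynomial.C + PB)

variable {A B : Matrix (Fin n) (Fin n) ℂ} {PA PB : Matrix (Fin n) (Fin n) (MvPolynomial ι ℂ)}

theorem familyPencil_map (x : ι → ℂ) :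
    (familyPencil A B PA PB).map (Polynomial.mapRingHom (MvPolynomial.eval x))
      = pencil (A + PA.map (MvPolynomial.eval x)) (B + PB.map (MvPolynomial.eval x)) := by
  ext1 i j
  simp [familyPencil]

theorem det_familyPencil_map (x : ι → ℂ) :
    (familyPencil A B PA PB).det.map (MvPolynomial.eval x)
      = pencilPoly n (A + PA.map (MvPolynomial.eval x)) (B + PB.map (MvPolynomial.eval x)) := by
  rw [← coe_mapRingHom, RingHom.map_det, RingHom.mapMatrix_apply, familyPencil_map]
  rfl

theorem pencil_add {R m : Type*} [CommRing R] (A B A' B' : Matrix m m R) :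
    pencil (A + A') (B + B') = pencil A B + pencil A' B' := by
  ext1 i j
  simp [mul_add]
  ring

theorem LowRankFamily.exists_eq_zero (h : LowRankFamily r PA PB) : ∃ x : ι → ℂ,
    PA.map (MvPolynomial.eval x) = 0 ∧ PB.map (MvPolynomial.eval x) = 0 := by
  obtain ⟨x, h1, h2⟩ := h.attain 0 0
  exact ⟨x, by simpa using h1, h2⟩

theorem LowRankFamily.regular (h : LowRankFamily r PA PB) (hreg : PencilRegular n A B) :
    HoldsGenerically fun x : ι → ℂ =>
      PencilRegular n (A + PA.map (MvPolynomial.eval x)) (B + PB.map (MvPolynomial.eval x)) := by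
  obtain ⟨x₀, hA, hB⟩ := h.exists_eq_zero
  have := holdsGenerically_map_ne_zero (F := (familyPencil A B PA PB).det) x₀
    (by rw [det_familyPencil_map, hA, hB, add_zero, add_zero]; exact hreg)
  simp only [det_familyPencil_map] at this
  exact this

/-- Generically the orders of vanishing of the minors at `z` are shifted by `r`. -/
theorem LowRankFamily.minorOrder_shift (h : LowRankFamily r PA PB) (hreg : PencilRegular n A B)
    (z : ℂ) :
    HoldsGenerically fun x : ι → ℂ => ∀ k ≤ n,
      minorOrder n k (A + PA.map (MvPolynomial.eval x)) (B + PB.map (MvPolynomial.eval x)) z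
        = minorOrder n (k - r) A B z := by
  obtain ⟨e, -, hsum⟩ := exists_minorOrder_eq_sum hreg z
  suffices H : ∀ k : Fin (n + 1), HoldsGenerically fun x : ι → ℂ =>
      minorOrder n k (A + PA.map (MvPolynomial.eval x)) (B + PB.map (MvPolynomial.eval x)) z
        = minorOrder n (k - r) A B z from
    (HoldsGenerically.forall H).mono fun x hx k hk => hx ⟨k, Nat.lt_succ_of_le hk⟩
  rintro ⟨k, hk⟩
  rw [Nat.lt_succ_iff] at hk
  have hm := hsum (k - r) (by omega)
  set a := ∑ i ∈ Finset.range (k - r), e i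
  have hlow : MinorsDvd ((X - C z) ^ a) (k - r) (pencil A B) :=
    natCast_le_minorOrder.mp hm.ge
  have hupp : ¬ MinorsDvd ((X - C z) ^ (a + 1)) (k - r) (pencil A B) := by
    rw [← natCast_le_minorOrder, hm, Nat.cast_le]
    omega
  obtain ⟨α, γ, hαγ⟩ := exists_not_minorsDvd (C : ℂ →+* ℂ[X]) hupp hk
  obtain ⟨x₀, hA, hB⟩ := h.attain α γ
  have hx₀ : pencil A B + (∑ t, vecMulVec (α t) (γ t)).map C
      = (familyPencil A B PA PB).map (Polynomial.mapRingHom (MvPolynomial.eval x₀)) := by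
    rw [familyPencil_map, hA, hB, pencil_add]
    simp [pencil]
  rw [hx₀] at hαγ
  simp only [MinorsDvd, not_forall] at hαγ
  obtain ⟨f, g, hfg⟩ := hαγ
  have hdet : ∀ x : ι → ℂ,
      ((familyPencil A B PA PB).submatrix f g).det.map (MvPolynomial.eval x)
        = (((familyPencil A B PA PB).map (Polynomial.mapRingHom (MvPolynomial.eval x))).submatrix
          f g).det := fun x => by
    rw [← coe_mapRingHom, RingHom.map_det, RingHom.mapMatrix_apply, submatrix_map]
  rw [← hdet] at hfg
  refine (holdsGenerically_not_dvd ((monic_X_sub_C z).pow _) x₀ hfg).mono fun x hx => ?_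
  rw [hm]
  refine minorOrder_eq_natCast ?_ fun hc => hx ?_
  · obtain ⟨u, v, huv⟩ := h.decomp x
    rw [pencil_add, huv]
    exact hlow.add_sum_vecMulVec u v
  · rw [hdet, familyPencil_map]
    exact hc f g

theorem degreeOf_det_le {R : Type*} [CommRing R] {c : ι}
    (M : Matrix (Fin n) (Fin n) (MvPolynomial ι R)) (k : Fin n)
    (h : ∀ i j, (M i j).degreeOf c ≤ if i = k then 1 else 0) : M.det.degreeOf c ≤ 1 := by
  rw [← det_transpose, det_apply]
  refine (MvPolynomial.degreeOf_sum_le _ _ _).trans (Finset.sup_le fun σ _ => ?_)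
  have hsign : ∀ p : MvPolynomial ι R,
      ((Equiv.Perm.sign σ) • p).degreeOf c ≤ p.degreeOf c := fun p => by
    rcases Int.units_eq_one_or (Equiv.Perm.sign σ) with hs | hs
    · simp [hs]
    · simp [hs]
  refine (hsign _).trans ((MvPolynomial.degreeOf_prod_le _ _ _).trans ?_)
  refine (Finset.sum_le_sum fun i _ => h i (σ i)).trans ?_
  simp

/-- Polynomials in `λ` with coefficients in the parameters, viewed as polynomials in the parameters
with coefficients in `ℂ[λ]`. -/
noncomputable def paramEquiv (ι : Type) : (MvPolynomial ι ℂ)[X] ≃ₐ[ℂ] MvPolynomial ι ℂ[X] :=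
  (MvPolynomial.optionEquivLeft ℂ ι).symm.trans (MvPolynomial.optionEquivRight ℂ ι)

theorem paramEquiv_X : paramEquiv ι X = MvPolynomial.C X := by
  have : MvPolynomial.optionEquivLeft ℂ ι (MvPolynomial.X none) = X := by simp
  rw [paramEquiv, AlgEquiv.trans_apply, ← this, AlgEquiv.symm_apply_apply,
    MvPolynomial.optionEquivRight_X_none]

theorem paramEquiv_C (p : MvPolynomial ι ℂ) :
    paramEquiv ι (C p) = MvPolynomial.map C p := by
  have : ((paramEquiv ι : _ →+* MvPolynomial ι ℂ[X]).comp C) = MvPolynomial.map C := by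
    refine MvPolynomial.ringHom_ext (fun a => ?_) fun i => ?_
    · have h1 := (paramEquiv ι).commutes a
      rw [MvPolynomial.map_C]
      exact h1
    · have h1 : MvPolynomial.optionEquivLeft ℂ ι (MvPolynomial.X (some i))
        = C (MvPolynomial.X i) := by simp
      rw [MvPolynomial.map_X, RingHom.comp_apply, ← h1]
      change MvPolynomial.optionEquivRight ℂ ι ((MvPolynomial.optionEquivLeft ℂ ι).symm _) = _
      rw [AlgEquiv.symm_apply_apply, MvPolynomial.optionEquivRight_X_some]
  exact congrArg (fun f : _ →+* _ => f p) this

theorem paramEquiv_map_C (q : ℂ[X]) :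
    paramEquiv ι (q.map MvPolynomial.C) = MvPolynomial.C q := by
  induction q using Polynomial.induction_on' with
  | add p q hp hq => rw [Polynomial.map_add, map_add, hp, hq, map_add]
  | monomial k a =>
    rw [map_monomial, ← C_mul_X_pow_eq_monomial, map_mul, map_pow, paramEquiv_X, paramEquiv_C,
      MvPolynomial.map_C, ← map_pow, ← map_mul, C_mul_X_pow_eq_monomial]

theorem LowRankFamily.degreeOf_det_le (h : LowRankFamily r PA PB) (c : ι) :
    (paramEquiv ι (familyPencil A B PA PB).det).degreeOf c ≤ 1 := by
  have hmap : ∀ p : MvPolynomial ι ℂ,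
      (MvPolynomial.map C p : MvPolynomial ι ℂ[X]).degreeOf c ≤ p.degreeOf c := fun p => by
    rw [MvPolynomial.degreeOf_le_iff]
    exact fun m hm => MvPolynomial.monomial_le_degreeOf c (MvPolynomial.support_map_subset _ _ hm)
  have hentry : ∀ i j d, (PA i j).degreeOf c ≤ d ∧ (PB i j).degreeOf c ≤ d →
      (paramEquiv ι (familyPencil A B PA PB i j)).degreeOf c ≤ d := by
    rintro i j d ⟨hA, hB⟩
    have : paramEquiv ι (familyPencil A B PA PB i j)
        = (MvPolynomial.C (C (A i j)) + MvPolynomial.map C (PA i j))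
          + MvPolynomial.C X * (MvPolynomial.C (C (B i j)) + MvPolynomial.map C (PB i j)) := by
      simp only [familyPencil, pencil, Matrix.add_apply, Matrix.map_apply, Matrix.smul_apply,
        smul_eq_mul, map_add, map_mul, paramEquiv_X, paramEquiv_C, MvPolynomial.map_C]
    have hadd : ∀ (a : ℂ[X]) (p : MvPolynomial ι ℂ), p.degreeOf c ≤ d →
        (MvPolynomial.C a + MvPolynomial.map C p).degreeOf c ≤ d := fun a p hp => by
      refine (MvPolynomial.degreeOf_add_le _ _ _).trans (max_le ?_ ((hmap p).trans hp))
      simp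
    rw [this]
    refine (MvPolynomial.degreeOf_add_le _ _ _).trans (max_le (hadd _ _ hA) ?_)
    refine (MvPolynomial.degreeOf_mul_le _ _ _).trans ?_
    rw [MvPolynomial.degreeOf_C, zero_add]
    exact hadd _ _ hB
  rw [AlgEquiv.map_det]
  rcases h.degree c with ⟨k, hk⟩ | ⟨k, hk⟩
  · exact _root_.degreeOf_det_le _ k fun i j => hentry i j _ (hk i j)
  · rw [← det_transpose]
    exact _root_.degreeOf_det_le _ k fun i j => hentry j i _ (hk j i)

/-- A polynomial of degree at most one in each parameter has no repeated factor involving a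
parameter. -/
theorem eq_map_C_of_mul_self_dvd {F p : (MvPolynomial ι ℂ)[X]} (hF : F ≠ 0)
    (hdeg : ∀ c, (paramEquiv ι F).degreeOf c ≤ 1) (hp : p * p ∣ F) :
    ∃ q : ℂ[X], p = q.map MvPolynomial.C := by
  obtain ⟨w, rfl⟩ := hp
  have hinj := (paramEquiv ι).injective
  have hw0 : paramEquiv ι w ≠ 0 := (map_ne_zero_iff _ hinj).mpr (right_ne_zero_of_mul hF)
  have hp0 : paramEquiv ι p ≠ 0 :=
    (map_ne_zero_iff _ hinj).mpr (left_ne_zero_of_mul (left_ne_zero_of_mul hF))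
  have hvars : (paramEquiv ι p).vars = ∅ := by
    refine Finset.eq_empty_of_forall_notMem fun c hc => ?_
    have := hdeg c
    rw [map_mul, map_mul, MvPolynomial.degreeOf_mul_eq (mul_ne_zero hp0 hp0) hw0,
      MvPolynomial.degreeOf_mul_eq hp0 hp0] at this
    have h0 : (paramEquiv ι p).degreeOf c = 0 := by omega
    obtain ⟨m, hm, hmc⟩ := (MvPolynomial.mem_vars_iff_mem_support c).mp hc
    have hle := MvPolynomial.monomial_le_degreeOf c hm
    exact Finsupp.mem_support_iff.mp hmc (by omega)
  refine ⟨(paramEquiv ι p).coeff 0, hinj ?_⟩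
  rw [paramEquiv_map_C]
  exact MvPolynomial.vars_eq_empty_iff_eq_C.mp hvars

/-- Generically the determinant has no multiple roots except at roots of `det (A + λ B)`. -/
theorem LowRankFamily.simple (h : LowRankFamily r PA PB) (hreg : PencilRegular n A B) :
    HoldsGenerically fun x : ι → ℂ => ∀ z, (pencilPoly n A B).eval z ≠ 0 →
      (pencilPoly n (A + PA.map (MvPolynomial.eval x))
        (B + PB.map (MvPolynomial.eval x))).rootMultiplicity z ≤ 1 := by
  set F := (familyPencil A B PA PB).det with hF
  obtain ⟨x₀, hA, hB⟩ := h.exists_eq_zero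
  have hx₀ : F.map (MvPolynomial.eval x₀) = pencilPoly n A B := by
    rw [hF, det_familyPencil_map, hA, hB, add_zero, add_zero]
  have hF0 : F ≠ 0 := fun h0 => hreg (by rw [← hx₀, h0, Polynomial.map_zero])
  obtain ⟨c, m, a, b, hc, hab⟩ := Polynomial.exists_C_mul_pow_eq_of_repeated_factors
    (N := (pencilPoly n A B).map MvPolynomial.C) hF0 fun p hp => by
      obtain ⟨q, rfl⟩ := eq_map_C_of_mul_self_dvd hF0 h.degreeOf_det_le hp
      have := Polynomial.map_dvd (MvPolynomial.eval x₀) ((dvd_mul_right _ _).trans hp)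
      rw [map_C_map_eval, hx₀] at this
      exact Polynomial.map_dvd _ this
  refine ⟨c, hc, fun x hx z hz => ?_⟩
  rw [← det_familyPencil_map, ← hF]
  by_contra! hmult
  set f := F.map (MvPolynomial.eval x) with hf
  have hmul := congrArg (fun p => (p.map (MvPolynomial.eval x)).eval z) hab
  simp only [Polynomial.map_mul, Polynomial.map_add, Polynomial.map_pow, map_C, map_C_map_eval, eval_mul,
    eval_add, eval_pow, eval_C, ← derivative_map, ← hf] at hmul
  have hdvd : (X - C z) ^ 2 ∣ f := (pow_dvd_pow _ hmult).trans (pow_rootMultiplicity_dvd f z)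
  obtain ⟨w, hw⟩ := hdvd
  have h1 : f.eval z = 0 := by simp [hw]
  have h2 : (derivative f).eval z = 0 := by simp [hw, derivative_pow]
  rw [h1, h2, mul_zero, mul_zero, add_zero] at hmul
  exact mul_ne_zero hx (pow_ne_zero m hz) hmul

end Family

section Parametrization

variable {n r s : ℕ}

/-- `Fin r` splits into its first `s` and its last `r - s` elements. -/
def finSplit (hs : s ≤ r) : Fin s ⊕ Fin (r - s) ≃ Fin r :=
  finSumFinEquiv.trans (finCongr (by omega))

theorem sum_finSplit {M : Type*} [AddCommMonoid M] (hs : s ≤ r) (f : Fin s ⊕ Fin (r - s) → M) :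
    ∑ t, f ((finSplit hs).symm t) = ∑ i, f (.inl i) + ∑ j, f (.inr j) := by
  rw [Equiv.sum_comp (finSplit hs).symm f, Fintype.sum_sum_type]

theorem finSplit_symm_castLE (hs : s ≤ r) (i : Fin s) :
    (finSplit hs).symm (Fin.castLE hs i) = .inl i :=
  (finSplit hs).symm_apply_eq.mpr (Fin.ext (by simp [finSplit]))

theorem finSplit_symm_idxHi (hs : s ≤ r) (j : Fin (r - s)) :
    (finSplit hs).symm (idxHi hs j) = .inr j :=
  (finSplit hs).symm_apply_eq.mpr (Fin.ext (by simp [finSplit, idxHi]))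

theorem sum_castLE_add_sum_idxHi {M : Type*} [AddCommMonoid M] (hs : s ≤ r) (f : Fin r → M) :
    ∑ i, f (Fin.castLE hs i) + ∑ j, f (idxHi hs j) = ∑ t, f t := by
  have h := sum_finSplit hs (f ∘ finSplit hs)
  simp only [Function.comp_apply, Equiv.apply_symm_apply] at h
  rw [h]
  rfl

/-- The constant coefficient of `Φ_s` with indeterminate parameters. -/
noncomputable def phiPolyA (n r s : ℕ) (hs : s ≤ r) :
    Matrix (Fin n) (Fin n) (MvPolynomial (Param13 r s n) ℂ) :=
  Matrix.of fun k l =>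
    ∑ i : Fin s, MvPolynomial.X (.inl (.inl (Fin.castLE hs i, k)))
      * MvPolynomial.X (.inl (.inr (Fin.castLE hs i, l)))
    + ∑ j : Fin (r - s), MvPolynomial.X (.inl (.inl (idxHi hs j, k)))
      * MvPolynomial.X (.inl (.inr (idxHi hs j, l)))

/-- The linear coefficient of `Φ_s` with indeterminate parameters. -/
noncomputable def phiPolyB (n r s : ℕ) (hs : s ≤ r) :
    Matrix (Fin n) (Fin n) (MvPolynomial (Param13 r s n) ℂ) :=
  Matrix.of fun k l =>
    ∑ i : Fin s, MvPolynomial.X (.inl (.inl (Fin.castLE hs i, k)))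
      * MvPolynomial.X (.inr (.inr (i, l)))
    + ∑ j : Fin (r - s), MvPolynomial.X (.inr (.inl (j, k)))
      * MvPolynomial.X (.inl (.inr (idxHi hs j, l)))

theorem phiPolyA_map (hs : s ≤ r) (x : Param13 r s n → ℂ) :
    (phiPolyA n r s hs).map (MvPolynomial.eval x) = Phi13A n r s hs x := by
  ext k l
  simp [phiPolyA, Phi13A, Matrix.sum_apply, vecMulVec_apply]

theorem phiPolyB_map (hs : s ≤ r) (x : Param13 r s n → ℂ) :
    (phiPolyB n r s hs).map (MvPolynomial.eval x) = Phi13B n r s hs x := by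
  ext k l
  simp [phiPolyB, Phi13B, Matrix.sum_apply, vecMulVec_apply]

theorem phi_decomp (hs : s ≤ r) (x : Param13 r s n → ℂ) (p q : ℂ[X]) :
    ∃ u v : Fin r → Fin n → ℂ[X],
      p • (Phi13A n r s hs x).map C + q • (Phi13B n r s hs x).map C
        = ∑ t, vecMulVec (u t) (v t) := by
  refine ⟨fun t => Sum.elim
      (fun i k => C (x (.inl (.inl (Fin.castLE hs i, k)))))
      (fun j k => p * C (x (.inl (.inl (idxHi hs j, k)))) + q * C (x (.inr (.inl (j, k)))))
      ((finSplit hs).symm t),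
    fun t => Sum.elim
      (fun i l => p * C (x (.inl (.inr (Fin.castLE hs i, l)))) + q * C (x (.inr (.inr (i, l)))))
      (fun j l => C (x (.inl (.inr (idxHi hs j, l))))) ((finSplit hs).symm t), ?_⟩
  rw [sum_finSplit hs fun t => vecMulVec (Sum.elim _ _ t) (Sum.elim _ _ t)]
  ext1 k l
  simp only [Sum.elim_inl, Sum.elim_inr, Phi13A, Phi13B, Matrix.add_apply, Matrix.smul_apply,
    Matrix.map_apply, Matrix.sum_apply, vecMulVec_apply, smul_eq_mul, map_add, map_sum, map_mul,
    mul_add, Finset.mul_sum, add_mul, Finset.sum_add_distrib]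
  simp only [mul_left_comm, mul_assoc]
  abel

theorem phi_degree (hs : s ≤ r) (c : Param13 r s n) :
    (∃ k, ∀ i j, (phiPolyA n r s hs i j).degreeOf c ≤ (if i = k then 1 else 0)
      ∧ (phiPolyB n r s hs i j).degreeOf c ≤ (if i = k then 1 else 0)) ∨
    (∃ k, ∀ i j, (phiPolyA n r s hs i j).degreeOf c ≤ (if j = k then 1 else 0)
      ∧ (phiPolyB n r s hs i j).degreeOf c ≤ (if j = k then 1 else 0)) := by
  classical
  have hX : ∀ (a b : Param13 r s n) (d : ℕ),
      ((if c = a then 1 else 0) + if c = b then 1 else 0) ≤ d →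
      (MvPolynomial.X a * MvPolynomial.X b : MvPolynomial (Param13 r s n) ℂ).degreeOf c ≤ d :=
    fun a b d h => (MvPolynomial.degreeOf_mul_le _ _ _).trans
      (by rwa [MvPolynomial.degreeOf_X, MvPolynomial.degreeOf_X])
  have hA : ∀ i j d, (∀ t, ((if c = .inl (.inl (t, i)) then 1 else 0)
      + if c = .inl (.inr (t, j)) then 1 else 0) ≤ d) →
      (phiPolyA n r s hs i j).degreeOf c ≤ d := fun i j d h => by
    refine (MvPolynomial.degreeOf_add_le _ _ _).trans (max_le ?_ ?_) <;>
    exact (MvPolynomial.degreeOf_sum_le _ _ _).trans (Finset.sup_le fun t _ => hX _ _ _ (h _))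
  have hB : ∀ i j d, (∀ t t', ((if c = .inl (.inl (t, i)) then 1 else 0)
      + if c = .inr (.inr (t', j)) then 1 else 0) ≤ d) →
      (∀ t t', ((if c = .inr (.inl (t', i)) then 1 else 0)
      + if c = .inl (.inr (t, j)) then 1 else 0) ≤ d) →
      (phiPolyB n r s hs i j).degreeOf c ≤ d := fun i j d h h' => by
    refine (MvPolynomial.degreeOf_add_le _ _ _).trans (max_le ?_ ?_)
    · exact (MvPolynomial.degreeOf_sum_le _ _ _).trans (Finset.sup_le fun t _ => hX _ _ _ (h _ _))
    · exact (MvPolynomial.degreeOf_sum_le _ _ _).trans (Finset.sup_le fun t _ => hX _ _ _ (h' _ _))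
  rcases c with (⟨t, k⟩ | ⟨t, k⟩) | (⟨t, k⟩ | ⟨t, k⟩)
  · refine .inl ⟨k, fun i j => ⟨hA i j _ fun t => ?_, hB i j _ (fun t t' => ?_) fun t t' => ?_⟩⟩ <;>
      simp <;> grind
  · refine .inr ⟨k, fun i j => ⟨hA i j _ fun t => ?_, hB i j _ (fun t t' => ?_) fun t t' => ?_⟩⟩ <;>
      simp <;> grind
  · refine .inl ⟨k, fun i j => ⟨hA i j _ fun t => ?_, hB i j _ (fun t t' => ?_) fun t t' => ?_⟩⟩ <;>
      simp; grind
  · refine .inr ⟨k, fun i j => ⟨hA i j _ fun t => ?_, hB i j _ (fun t t' => ?_) fun t t' => ?_⟩⟩ <;>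
      simp; grind

theorem lowRankFamily_phi (hs : s ≤ r) :
    LowRankFamily r (phiPolyA n r s hs) (phiPolyB n r s hs) where
  decomp x := by
    obtain ⟨u, v, h⟩ := phi_decomp hs x 1 X
    exact ⟨u, v, by rw [phiPolyA_map, phiPolyB_map, ← h, one_smul]⟩
  attain α γ := by
    refine ⟨Sum.elim (Sum.elim (fun p => α p.1 p.2) fun p => γ p.1 p.2) 0, ?_, ?_⟩
    · rw [phiPolyA_map, ← sum_castLE_add_sum_idxHi hs]
      rfl
    · rw [phiPolyB_map]
      ext k l
      simp [Phi13B, Matrix.sum_apply, vecMulVec_apply]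
  degree := phi_degree hs

theorem lowRankFamily_phi_swap (hs : s ≤ r) :
    LowRankFamily r (phiPolyB n r s hs) (phiPolyA n r s hs) where
  decomp x := by
    obtain ⟨u, v, h⟩ := phi_decomp hs x X 1
    exact ⟨u, v, by rw [phiPolyA_map, phiPolyB_map, ← h, one_smul, add_comm]⟩
  attain α γ := by
    refine ⟨Sum.elim
      (Sum.elim
        (fun p => Sum.elim (fun _ => α p.1 p.2) (fun _ => 0) ((finSplit hs).symm p.1))
        (fun p => Sum.elim (fun _ => 0) (fun _ => γ p.1 p.2) ((finSplit hs).symm p.1)))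
      (Sum.elim (fun p => α (idxHi hs p.1) p.2) fun p => γ (Fin.castLE hs p.1) p.2), ?_, ?_⟩
    · rw [phiPolyB_map, ← sum_castLE_add_sum_idxHi hs]
      ext k l
      simp [Phi13B, Matrix.sum_apply, vecMulVec_apply, finSplit_symm_castLE, finSplit_symm_idxHi]
    · rw [phiPolyA_map]
      ext k l
      simp [Phi13A, Matrix.sum_apply, vecMulVec_apply, finSplit_symm_castLE, finSplit_symm_idxHi]
  degree c := (phi_degree hs c).imp (fun ⟨k, h⟩ => ⟨k, fun i j => (h i j).symm⟩)
    fun ⟨k, h⟩ => ⟨k, fun i j => (h i j).symm⟩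

theorem eval_pencilPoly (A B : Matrix (Fin n) (Fin n) ℂ) (z : ℂ) :
    (pencilPoly n A B).eval z = (A + z • B).det := by
  rw [pencilPoly, ← coe_evalRingHom, RingHom.map_det]
  congr 1
  ext i j
  simp
  ring

theorem PencilRegular.swap {A B : Matrix (Fin n) (Fin n) ℂ} (h : PencilRegular n A B) :
    PencilRegular n B A := fun h0 => h <| by
  have hX : (X : ℂ[X]) * pencilPoly n A B = 0 := by
    refine Polynomial.funext fun z => ?_
    rw [eval_mul, eval_X, eval_zero, mul_eq_zero, or_iff_not_imp_left]
    intro hz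
    have h1 : A + z • B = z • (B + z⁻¹ • A) := by
      rw [smul_add, smul_smul, mul_inv_cancel₀ hz, one_smul, add_comm]
    rw [eval_pencilPoly, h1, det_smul, ← eval_pencilPoly, h0, eval_zero, mul_zero]
  exact (mul_eq_zero.mp hX).resolve_left X_ne_zero

end Parametrization

/-- **Generic change under low-rank perturbations of general regular matrix pencils.**
If `L(λ) = A + λB` is regular with pairwise distinct eigenvalues `Λ 1, …, Λ κ`
(finite or infinite, `none` denoting `∞`) with partial multiplicities
`nn i 0 ≥ nn i 1 ≥ … ≥ nn i (g i − 1) > 0` (`nn i j = 0` for `j ≥ g i`), then for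
`1 ≤ r` and `s ≤ r` there is a generic set `G_s ⊆ ℂ^{3rn}` such that for all
`x ∈ G_s`, with `E = Φ_s(x)`: `L + E` is regular; the partial multiplicities of
`L + E` at `Λ i` are exactly `nn i r ≥ … ≥ nn i (g i − 1)` (so if `r ≥ g i` then
`Λ i` is not an eigenvalue of `L + E`); and every eigenvalue of `L + E` that is not
an eigenvalue of `L` is simple. -/
theorem generic_low_rank_perturbation_general
    (n κ r s : ℕ) (hr : 1 ≤ r) (hs : s ≤ r)
    (A B : Matrix (Fin n) (Fin n) ℂ)
    (hreg : PencilRegular n A B)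
    (Λ : Fin κ → Option ℂ) (hΛ : Function.Injective Λ)
    (heig : ∀ μ : Option ℂ, IsEigenvalue n A B μ ↔ ∃ i, Λ i = μ)
    (g : Fin κ → ℕ) (nn : Fin κ → ℕ → ℕ)
    (hmono : ∀ i, ∀ j k : ℕ, j ≤ k → nn i k ≤ nn i j)
    (hgpos : ∀ i, ∀ j : ℕ, 0 < nn i j ↔ j < g i)
    (hpm : ∀ i, pmAt n A B (Λ i) = (Multiset.range (g i)).map (nn i)) :
    ∃ G : Set (Param13 r s n → ℂ), IsGenericC (Param13 r s n) G ∧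
      ∀ x ∈ G,
        PencilRegular n (A + Phi13A n r s hs x) (B + Phi13B n r s hs x) ∧
        (∀ i, pmAt n (A + Phi13A n r s hs x) (B + Phi13B n r s hs x) (Λ i)
            = (Multiset.range (g i - r)).map fun j => nn i (r + j)) ∧
        (∀ μ : Option ℂ,
          IsEigenvalue n (A + Phi13A n r s hs x) (B + Phi13B n r s hs x) μ →
          ¬ IsEigenvalue n A B μ →
          algMultAt n (A + Phi13A n r s hs x) (B + Phi13B n r s hs x) μ = 1) := by
  have hF := lowRankFamily_phi (n := n) hs
  have hF' := lowRankFamily_phi_swap (n := n) hs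
  have hgen_pm : ∀ i, HoldsGenerically fun x : Param13 r s n → ℂ =>
      pmAt n (A + Phi13A n r s hs x) (B + Phi13B n r s hs x) (Λ i)
        = (Multiset.range (g i - r)).map fun j => nn i (r + j) := by
    intro i
    have hi := hpm i
    rcases hΛi : Λ i with _ | z
    · rw [hΛi] at hi
      refine (hF'.minorOrder_shift hreg.swap 0).mono fun x hx => ?_
      rw [phiPolyA_map, phiPolyB_map] at hx
      exact pmFin_of_minorOrder_shift hreg.swap hx (hmono i) (hgpos i) hi
    · rw [hΛi] at hi
      refine (hF.minorOrder_shift hreg z).mono fun x hx => ?_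
      rw [phiPolyA_map, phiPolyB_map] at hx
      exact pmFin_of_minorOrder_shift hreg hx (hmono i) (hgpos i) hi
  have hgen := (hF.regular hreg).and <| (HoldsGenerically.forall hgen_pm).and <|
    (hF.simple hreg).and (hF'.simple hreg.swap)
  refine ⟨_, hgen.isGenericC, fun x hx => ?_⟩
  obtain ⟨hxreg, hxpm, hxs, hxs'⟩ := hx
  rw [phiPolyA_map, phiPolyB_map] at hxreg hxs hxs'
  have hmult : ∀ {A B A' B' : Matrix (Fin n) (Fin n) ℂ} (z : ℂ), PencilRegular n A B →
      PencilRegular n A' B' → (∀ z, (pencilPoly n A B).eval z ≠ 0 →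
        (pencilPoly n A' B').rootMultiplicity z ≤ 1) →
      pmFin n A' B' z ≠ 0 → ¬ pmFin n A B z ≠ 0 → (pencilPoly n A' B').rootMultiplicity z = 1 := by
    intro A B A' B' z h h' hle hne heq
    rw [not_not, pmFin_eq_zero_iff h] at heq
    rw [Ne, pmFin_eq_zero_iff h', not_not] at hne
    exact le_antisymm (hle z heq) ((rootMultiplicity_pos h').mpr hne)
  refine ⟨hxreg, hxpm, fun μ hμ hμ' => ?_⟩
  rcases μ with _ | z
  · exact hmult 0 hreg.swap hxreg.swap hxs' hμ hμ'
  · exact hmult z hreg hxreg hxs hμ hμ'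
end
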